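/- Let K be a real differential field whose field of constants k is real closed, let A ∈ Mat_n(K), and let L₁, L₂ be two real Picard–Vessiot fields for y′ = Ay over K. Suppose τ₁, τ₂ are orderings of L₁, L₂ respectively which restrict to the same ordering τ of K. For j = 1, 2 let L_j^r be a real closure of (L_j, τ_j) (a real closed algebraic field extension of L_j whose unique ordering extends τ_j), equipped with the unique derivation extending that of L_j, and let K_j be the relative algebraic closure of K in L_j^r. Then: (a) each K_j is a real closure of (K, τ); (b) the compositum L̃_j := K_j · L_j inside L_j^r is a real Picard–Vessiot field for y′ = Ay over K_j; and (c) identifying K₁ with K₂ via the unique K-linear field isomorphism between these real closures of (K, τ), the fields L̃₁ and L̃₂ are isomorphic as differential field extensions of this real closure if and only if L₁ and L₂ are isomorphic as differential field extensions of K. -/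

import Mathlib

/-- A derivation on a field `F`. -/
structure FieldDeriv (F : Type) [Field F] : Type where
  d : F → F
  map_add : ∀ a b : F, d (a + b) = d a + d b
  leibniz : ∀ a b : F, d (a * b) = a * d b + d a * b

/-- A field is (formally) real if `-1` is not a sum of squares. -/
def IsFormallyRealField (F : Type) [Field F] : Prop :=
  ¬ IsSumSq (-1 : F)

/-- A field is real closed if it is real and no proper algebraic extension of it is real. -/
def IsRealClosedField (F : Type) [Field F] : Prop :=
  IsFormallyRealField F ∧
    ∀ (E : Type) [Field E] [Algebra F E], Algebra.IsAlgebraic F E →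
      IsFormallyRealField E → Function.Surjective (algebraMap F E)

/-- An ordering of a field `F`, given by its positive cone `P` (the set of nonnegative
elements). -/
structure FieldOrdering (F : Type) [Field F] : Type where
  P : Set F
  add_mem : ∀ x ∈ P, ∀ y ∈ P, x + y ∈ P
  mul_mem : ∀ x ∈ P, ∀ y ∈ P, x * y ∈ P
  total : ∀ x : F, x ∈ P ∨ -x ∈ P
  neg_one_not_mem : (-1 : F) ∉ P

/-- `L/K`, with derivations `dL` extending `dK`, is a Picard--Vessiot field for `y' = A y`. -/
def IsPicardVessiot {K L : Type} [Field K] [Field L] [Algebra K L]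
    (dK : FieldDeriv K) (dL : FieldDeriv L) {n : ℕ}
    (A : Matrix (Fin n) (Fin n) K) : Prop :=
  (∀ a : K, dL.d (algebraMap K L a) = algebraMap K L (dK.d a)) ∧
  ∃ F : Matrix (Fin n) (Fin n) L, IsUnit F.det ∧
    (∀ i j, dL.d (F i j) = (A.map (algebraMap K L) * F) i j) ∧
    IntermediateField.adjoin K (Set.range fun q : Fin n × Fin n => F q.1 q.2) = ⊤ ∧
    ∀ x : L, dL.d x = 0 → ∃ a : K, dK.d a = 0 ∧ algebraMap K L a = x

section RealClosedFields

open Polynomial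

/-- Polynomial functions on the ordered field `R` have the intermediate value property. -/
def PolynomialIVT (R : Type) [Field R] [LinearOrder R] : Prop :=
  ∀ (f : R[X]) (a b : R), a < b → f.eval a * f.eval b < 0 → ∃ c, a < c ∧ c < b ∧ f.eval c = 0

theorem AdjoinRoot.exists_mem_of_isSumSq {F : Type} [Field F] {f : F[X]} (hf : 0 < f.natDegree)
    (S : AddSubmonoid F[X]) (hS : ∀ g : F[X], g.natDegree < f.natDegree → g * g ∈ S)
    {z : AdjoinRoot f} (hz : IsSumSq z) : ∃ p ∈ S, AdjoinRoot.mk f p = z := by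
  induction hz with
  | zero => exact ⟨0, S.zero_mem, map_zero _⟩
  | sq_add a _ ih =>
    obtain ⟨p, hp, rfl⟩ := ih
    obtain ⟨g, rfl⟩ := AdjoinRoot.mk_surjective a
    have h1 : AdjoinRoot.mk f (g % f) = AdjoinRoot.mk f g := by
      rw [AdjoinRoot.mk_eq_mk]
      exact ⟨-(g / f), by linear_combination EuclideanDomain.mod_add_div g f⟩
    refine ⟨(g % f) * (g % f) + p, S.add_mem (hS _ ?_) hp, by simp [h1]⟩
    exact Polynomial.natDegree_mod_lt g hf.ne'

theorem IsSumSq.map_ringHom {F E : Type} [Field F] [Field E] (φ : F →+* E) {x : F}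
    (hx : IsSumSq x) : IsSumSq (φ x) := by
  induction hx with
  | zero => simp
  | sq_add a _ ih => simpa using IsSumSq.sq_add (φ a) ih

theorem IsFormallyRealField.of_ringHom {F E : Type} [Field F] [Field E] (φ : F →+* E)
    (hE : IsFormallyRealField E) : IsFormallyRealField F := fun h => hE (by
  simpa using h.map_ringHom φ)

theorem IsRealClosedField.isSumSq_neg_of_not_isSquare {F : Type} [Field F]
    (hF : IsRealClosedField F) {a : F} (ha : ¬ IsSquare a) :
    ∃ s t : F, IsSumSq s ∧ IsSumSq t ∧ t ≠ 0 ∧ 1 + s = -(a * t) := by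
  have hdeg : (X ^ 2 - C a : F[X]).natDegree = 2 := natDegree_X_pow_sub_C
  have hirr : Irreducible (X ^ 2 - C a : F[X]) := by
    apply irreducible_of_degree_le_three_of_not_isRoot
    · rw [hdeg]; decide
    · intro x hx
      exact ha ⟨x, by simp [sub_eq_zero] at hx; rw [← hx, sq]⟩
  have : Fact (Irreducible (X ^ 2 - C a : F[X])) := ⟨hirr⟩
  have hne : (X ^ 2 - C a : F[X]) ≠ 0 := hirr.ne_zero
  have hnr : ¬ IsFormallyRealField (AdjoinRoot (X ^ 2 - C a : F[X])) := by
    intro h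
    have halg : Algebra.IsAlgebraic F (AdjoinRoot (X ^ 2 - C a : F[X])) := by
      have := (AdjoinRoot.powerBasis hne).finite
      exact Algebra.IsAlgebraic.of_finite _ _
    obtain ⟨x, hx⟩ := hF.2 _ halg h (AdjoinRoot.root _)
    apply ha
    refine ⟨x, ?_⟩
    have h1 : (AdjoinRoot.root (X ^ 2 - C a : F[X])) ^ 2 = algebraMap F _ a := by
      have := AdjoinRoot.eval₂_root (X ^ 2 - C a : F[X])
      simpa [sub_eq_zero] using this
    rw [← hx, ← map_pow] at h1
    rw [← sq]
    exact ((algebraMap F (AdjoinRoot (X ^ 2 - C a : F[X]))).injective h1).symm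
  simp only [IsFormallyRealField, not_not] at hnr
  let S : AddSubmonoid F[X] :=
    { carrier := {p | p.natDegree ≤ 2 ∧ IsSumSq (p.coeff 0) ∧ IsSumSq (p.coeff 2)}
      zero_mem' := by simp
      add_mem' := fun {p q} hp hq => ⟨(natDegree_add_le _ _).trans (max_le hp.1 hq.1),
        by simpa using hp.2.1.add hq.2.1, by simpa using hp.2.2.add hq.2.2⟩ }
  obtain ⟨p, ⟨hp1, hp2, hp3⟩, hp⟩ := AdjoinRoot.exists_mem_of_isSumSq (by rw [hdeg]; decide) S
    (fun g hg => by
      rw [hdeg] at hg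
      have hg1 : g.natDegree ≤ 1 := by omega
      refine ⟨natDegree_mul_le.trans (by omega), ?_, ?_⟩
      · simp [mul_coeff_zero]
      · have : (g * g).coeff 2 = g.coeff 1 * g.coeff 1 := coeff_mul_add_eq_of_natDegree_le hg1 hg1
        simp [this]) hnr
  have hdvd : (X ^ 2 - C a : F[X]) ∣ 1 + p := by
    rw [← AdjoinRoot.mk_eq_zero]; simp [hp]
  obtain ⟨h, hh⟩ := hdvd
  have hh0 : h.natDegree = 0 := by
    by_cases h0 : h = 0
    · simp [h0]
    have h1 : (1 + p).natDegree = 2 + h.natDegree := by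
      rw [hh, natDegree_mul hne h0, hdeg]
    have h2 : (1 + p).natDegree ≤ 2 := (natDegree_add_le _ _).trans (max_le (by simp) hp1)
    omega
  obtain ⟨c, rfl⟩ := natDegree_eq_zero.mp hh0
  have e0 := congrArg (fun q => coeff q 0) hh
  have e2 := congrArg (fun q => coeff q 2) hh
  simp [coeff_one, coeff_X_pow] at e0 e2
  refine ⟨p.coeff 0, p.coeff 2, hp2, hp3, ?_, by rw [e0, e2]⟩
  intro h0
  rw [← e2, h0] at e0
  refine hF.1 ?_
  have : (-1 : F) = p.coeff 0 := by linear_combination -e0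
  rwa [this]

theorem IsRealClosedField.isSquare_of_isSumSq {F : Type} [Field F]
    (hF : IsRealClosedField F) {a : F} (ha : IsSumSq a) : IsSquare a := by
  by_contra hn
  obtain ⟨s, t, hs, ht, -, h⟩ := hF.isSumSq_neg_of_not_isSquare hn
  refine hF.1 ?_
  have : (-1 : F) = s + a * t := by linear_combination -h
  rw [this]
  exact hs.add (ha.mul ht)

theorem IsRealClosedField.isSquare_or_isSquare_neg {F : Type} [Field F]
    (hF : IsRealClosedField F) (a : F) : IsSquare a ∨ IsSquare (-a) := by
  by_contra! hn
  obtain ⟨s, t, hs, ht, h0, h⟩ := hF.isSumSq_neg_of_not_isSquare hn.1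
  apply hn.2
  obtain ⟨u, hu⟩ := hF.isSquare_of_isSumSq
    (((IsSumSq.mul_self (1 : F)).add (by simpa using hs)).mul ht)
  refine ⟨u / t, ?_⟩
  field_simp
  linear_combination hu - t * h

theorem IsRealClosedField.exists_linearOrder {F : Type} [Field F] (hF : IsRealClosedField F) :
    ∃ _ : LinearOrder F, IsStrictOrderedRing F := by
  classical
  let C : RingCone F :=
    { carrier := {x | IsSumSq x}
      mul_mem' := fun {a b} ha hb => IsSumSq.mul ha hb
      one_mem' := by simp
      add_mem' := fun {a b} ha hb => IsSumSq.add ha hb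
      zero_mem' := by simp
      eq_zero_of_mem_of_neg_mem' := by
        intro a ha hb
        by_contra h0
        refine hF.1 ?_
        obtain ⟨x, hx⟩ := hF.isSquare_of_isSumSq ha
        obtain ⟨y, hy⟩ := hF.isSquare_of_isSumSq hb
        have hx0 : x ≠ 0 := by rintro rfl; simp at hx; exact h0 hx
        have : (-1 : F) = (y / x) * (y / x) := by
          field_simp
          linear_combination hy + hx
        rw [this]
        simp }
  have : HasMemOrNegMem C := ⟨fun a => (hF.isSquare_or_isSquare_neg a).imp
    (fun h => h.isSumSq) (fun h => h.isSumSq)⟩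
  let : LinearOrder F := LinearOrder.mkOfAddGroupCone C
  have : IsOrderedRing F := IsOrderedRing.mkOfCone C
  exact ⟨inferInstance, IsOrderedRing.toIsStrictOrderedRing F⟩

theorem Polynomial.exists_irreducible_dvd_of_eval_mul_neg {F : Type} [Field F] [LinearOrder F]
    [IsStrictOrderedRing F] (a b : F) (h : F[X]) (hab : h.eval a * h.eval b < 0) :
    ∃ g : F[X], Irreducible g ∧ g ∣ h ∧ g.eval a * g.eval b < 0 := by
  induction h using WfDvdMonoid.induction_on_irreducible with
  | zero => simp at hab
  | unit u hu =>
    obtain ⟨c, hc, rfl⟩ := Polynomial.isUnit_iff.mp hu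
    simp at hab
    nlinarith [mul_self_nonneg c]
  | mul p i hp hi ih =>
    by_cases h1 : i.eval a * i.eval b < 0
    · exact ⟨i, hi, dvd_mul_right _ _, h1⟩
    · simp only [eval_mul] at hab
      have h2 : p.eval a * p.eval b < 0 := by
        by_contra h3
        push Not at h1 h3
        nlinarith [mul_nonneg h1 h3]
      obtain ⟨g, hg, hgd, hgs⟩ := ih h2
      exact ⟨g, hg, hgd.mul_left _, hgs⟩

theorem Polynomial.adjoinRoot_formallyReal_of_eval_mul_neg {F : Type} [Field F] [LinearOrder F]
    [IsStrictOrderedRing F] (a b : F) (f : F[X]) [hf : Fact (Irreducible f)]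
    (hab : f.eval a * f.eval b < 0) : IsFormallyRealField (AdjoinRoot f) := by
  induction hn : f.natDegree using Nat.strong_induction_on generalizing f with
  | _ n ih =>
  subst hn
  intro hsq
  have hpos : 0 < f.natDegree := hf.out.natDegree_pos
  let S : AddSubmonoid F[X] :=
    { carrier := {p | p.natDegree ≤ 2 * (f.natDegree - 1) ∧ IsSumSq p ∧ ∀ x, 0 ≤ p.eval x}
      zero_mem' := by simp
      add_mem' := fun {p q} hp hq => ⟨(natDegree_add_le _ _).trans (max_le hp.1 hq.1),
        hp.2.1.add hq.2.1, fun x => by simpa using add_nonneg (hp.2.2 x) (hq.2.2 x)⟩ }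
  obtain ⟨p, ⟨hp1, hp2, hp3⟩, hp⟩ := AdjoinRoot.exists_mem_of_isSumSq hpos S
    (fun g hg => by
      refine ⟨natDegree_mul_le.trans (by omega), by simp, fun x => ?_⟩
      simpa using mul_self_nonneg _) hsq
  have hdvd : f ∣ 1 + p := by
    rw [← AdjoinRoot.mk_eq_zero]; simp [hp]
  obtain ⟨h, hh⟩ := hdvd
  have hev : ∀ x, 0 < f.eval x * h.eval x := fun x => by
    rw [← eval_mul, ← hh, eval_add, eval_one]
    linarith [hp3 x]
  have hh0 : h ≠ 0 := by
    rintro rfl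
    simpa using hev 0
  have hhab : h.eval a * h.eval b < 0 := by
    by_contra hc
    push Not at hc
    have := mul_pos (hev a) (hev b)
    nlinarith [mul_nonneg hc (neg_nonneg.mpr hab.le)]
  obtain ⟨g, hg, hgd, hgs⟩ := Polynomial.exists_irreducible_dvd_of_eval_mul_neg a b h hhab
  have : Fact (Irreducible g) := ⟨hg⟩
  have hdeg : h.natDegree < f.natDegree := by
    have h1 : (1 + p).natDegree = f.natDegree + h.natDegree := by
      rw [hh, natDegree_mul hf.out.ne_zero hh0]
    have h2 : (1 + p).natDegree ≤ 2 * (f.natDegree - 1) :=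
      (natDegree_add_le _ _).trans (max_le (by simp) hp1)
    omega
  refine ih g.natDegree ((natDegree_le_of_dvd hgd hh0).trans_lt hdeg) g hgs rfl ?_
  have h3 : AdjoinRoot.mk g p = -1 := by
    have : AdjoinRoot.mk g (1 + p) = 0 := by
      rw [AdjoinRoot.mk_eq_zero, hh]; exact hgd.mul_left _
    rw [map_add, map_one] at this
    linear_combination this
  rw [← h3]
  clear * - hp2
  induction hp2 with
  | zero => simp
  | sq_add a _ ih => simpa using IsSumSq.sq_add (AdjoinRoot.mk g a) ih

theorem IsRealClosedField.polynomialIVT {F : Type} [Field F] [LinearOrder F]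
    [IsStrictOrderedRing F] (hF : IsRealClosedField F) : PolynomialIVT F := by
  intro f a b hlt hab
  obtain ⟨g, hg, hgd, hgs⟩ := Polynomial.exists_irreducible_dvd_of_eval_mul_neg a b f hab
  have : Fact (Irreducible g) := ⟨hg⟩
  have halg : Algebra.IsAlgebraic F (AdjoinRoot g) := by
    have := (AdjoinRoot.powerBasis hg.ne_zero).finite
    exact Algebra.IsAlgebraic.of_finite _ _
  obtain ⟨x, hx⟩ := hF.2 _ halg (Polynomial.adjoinRoot_formallyReal_of_eval_mul_neg a b g hgs)
    (AdjoinRoot.root _)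
  have hroot : g.eval x = 0 := by
    have h1 := AdjoinRoot.eval₂_root g
    rw [← hx, AdjoinRoot.algebraMap_eq] at h1
    rw [Polynomial.eval₂_at_apply] at h1
    exact (AdjoinRoot.of g).injective (by rw [h1, map_zero])
  have hlin : g.natDegree = 1 :=
    natDegree_eq_of_degree_eq_some (degree_eq_one_of_irreducible_of_root hg hroot)
  obtain ⟨k, hk⟩ := dvd_iff_isRoot.mpr hroot
  have hk0 : k.natDegree = 0 := by
    have hne : k ≠ 0 := by rintro rfl; exact hg.ne_zero (by simpa using hk)
    have := congrArg natDegree hk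
    rw [natDegree_mul (X_sub_C_ne_zero x) hne, natDegree_X_sub_C, hlin] at this
    omega
  obtain ⟨c, rfl⟩ := natDegree_eq_zero.mp hk0
  rw [hk] at hgs
  simp at hgs
  have hs : (a - x) * (b - x) < 0 := by
    by_contra hc
    push Not at hc
    nlinarith [mul_nonneg hc (mul_self_nonneg c)]
  refine ⟨x, ?_, ?_, ?_⟩
  · by_contra hc; push Not at hc; nlinarith
  · by_contra hc; push Not at hc; nlinarith
  · obtain ⟨q, rfl⟩ := hgd; simp [hroot]

theorem PolynomialIVT.isSquare_of_nonneg {F : Type} [Field F] [LinearOrder F]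
    [IsStrictOrderedRing F] (hF : PolynomialIVT F) {a : F} (ha : 0 ≤ a) : IsSquare a := by
  rcases ha.eq_or_lt with rfl | ha
  · simp
  obtain ⟨c, -, -, hc⟩ := hF (X ^ 2 - C a) 0 (1 + a) (by linarith) (by
    simp; nlinarith [mul_pos ha ha, mul_pos ha (mul_pos ha ha)])
  exact ⟨c, by simp [sub_eq_zero] at hc; rw [← hc, sq]⟩

end RealClosedFields

section OrderedFieldCalculus

open Polynomial

variable {R : Type} [Field R] [LinearOrder R] [IsStrictOrderedRing R]

theorem PolynomialIVT.eval_mul_pos (hR : PolynomialIVT R) {f : R[X]} {x y : R}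
    (h : ∀ c ∈ Set.uIcc x y, f.eval c ≠ 0) : 0 < f.eval x * f.eval y := by
  wlog hxy : x ≤ y generalizing x y
  · rw [mul_comm]
    exact this (by rwa [Set.uIcc_comm]) (le_of_not_ge hxy)
  rw [Set.uIcc_of_le hxy] at h
  have hx := h x ⟨le_rfl, hxy⟩
  have hy := h y ⟨hxy, le_rfl⟩
  by_contra hc
  have hlt : f.eval x * f.eval y < 0 := lt_of_le_of_ne (not_lt.mp hc) (mul_ne_zero hx hy)
  rcases hxy.eq_or_lt with rfl | hxy
  · exact (mul_self_nonneg _).not_gt hlt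
  obtain ⟨c, h1, h2, h3⟩ := hR f x y hxy hlt
  exact h c ⟨h1.le, h2.le⟩ h3

/-- Rolle's theorem for polynomials. -/
theorem PolynomialIVT.exists_derivative_eval_eq_zero (hR : PolynomialIVT R) {f : R[X]} (hf : f ≠ 0)
    {a b : R} (hab : a < b) (ha : f.eval a = 0) (hb : f.eval b = 0) :
    ∃ c, a < c ∧ c < b ∧ (derivative f).eval c = 0 := by
  wlog hmin : ∀ r, a < r → r < b → f.eval r ≠ 0 generalizing b
  · obtain ⟨b', hb', hbmin⟩ := Finset.exists_minimal (s := f.roots.toFinset.filter (a < ·))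
      ⟨b, by simp [hf, hab, hb]⟩
    simp only [Finset.mem_filter, Multiset.mem_toFinset, mem_roots hf, IsRoot.def] at hb' hbmin
    have hbb : b' ≤ b := by
      by_contra! hlt
      exact absurd (hbmin ⟨hb, hab⟩ hlt.le) (not_le.mpr hlt)
    obtain ⟨c, h1, h2, h3⟩ := this hb'.2 hb'.1 (fun r h1 h2 h3 =>
      absurd (hbmin ⟨h3, h1⟩ h2.le) (not_le.mpr h2))
    exact ⟨c, h1, h2.trans_le hbb, h3⟩
  obtain ⟨g₁, hg₁, hg₁a⟩ := exists_eq_pow_rootMultiplicity_mul_and_not_dvd f hf a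
  set m := f.rootMultiplicity a with hm
  have hg₁0 : g₁ ≠ 0 := by rintro rfl; simp at hg₁a
  obtain ⟨g, hg, hgb⟩ := exists_eq_pow_rootMultiplicity_mul_and_not_dvd g₁ hg₁0 b
  set l := g₁.rootMultiplicity b with hl
  have hm0 : 0 < m := (rootMultiplicity_pos hf).mpr ha
  have hl0 : 0 < l := by
    refine (rootMultiplicity_pos hg₁0).mpr ?_
    have h1 := hb
    rw [hg₁, eval_mul] at h1
    refine (mul_eq_zero.mp h1).resolve_left ?_
    simp [sub_ne_zero.mpr hab.ne']
  have hfg : f = (X - C a) ^ m * (X - C b) ^ l * g := by rw [hg₁, hg]; ring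
  have hne : ∀ c ∈ Set.uIcc a b, g.eval c ≠ 0 := by
    rw [Set.uIcc_of_le hab.le]
    rintro c ⟨h1, h2⟩ h3
    rcases h1.eq_or_lt with rfl | h1
    · apply hg₁a
      rw [hg]
      exact (dvd_iff_isRoot.mpr h3).mul_left _
    rcases h2.eq_or_lt with rfl | h2
    · exact hgb (dvd_iff_isRoot.mpr h3)
    exact hmin c h1 h2 (by rw [hfg, eval_mul, h3, mul_zero])
  have hpos := hR.eval_mul_pos hne
  obtain ⟨m, hm⟩ := Nat.exists_eq_succ_of_ne_zero hm0.ne'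
  obtain ⟨l, hl⟩ := Nat.exists_eq_succ_of_ne_zero hl0.ne'
  rw [hm, hl] at hfg
  let k : R[X] := ((m : R[X]) + 1) * (X - C b) * g + ((l : R[X]) + 1) * (X - C a) * g
    + (X - C a) * (X - C b) * derivative g
  have hk : derivative f = (X - C a) ^ m * (X - C b) ^ l * k := by
    rw [hfg]
    simp only [derivative_mul, derivative_X_sub_C_pow, Nat.succ_eq_add_one, Nat.add_sub_cancel, k,
      Nat.cast_add, Nat.cast_one, map_add, map_natCast, map_one]
    ring
  have hka : k.eval a = (m + 1) * (a - b) * g.eval a := by simp [k]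
  have hkb : k.eval b = (l + 1) * (b - a) * g.eval b := by simp [k]
  obtain ⟨c, h1, h2, h3⟩ := hR k a b hab (by
    rw [hka, hkb]
    have : (m + 1 : R) * (a - b) * eval a g * ((l + 1) * (b - a) * eval b g)
      = -((m + 1) * (l + 1) * (b - a) ^ 2 * (eval a g * eval b g)) := by ring
    rw [this]
    have := sub_pos.mpr hab
    have : 0 < (m + 1 : R) * (l + 1) * (b - a) ^ 2 * (eval a g * eval b g) := by positivity
    linarith)
  exact ⟨c, h1, h2, by rw [hk, eval_mul, h3, mul_zero]⟩

theorem PolynomialIVT.isolated_root (hR : PolynomialIVT R) {f : R[X]} (hf : f ≠ 0) {l u α : R}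
    (hl : l < α) (hu : α < u) (hα : f.eval α = 0)
    (hcrit : ∀ c, l < c → c < u → (derivative f).eval c ≠ 0) :
    f.eval l * f.eval u < 0 ∧ ∀ x, l ≤ x → x ≤ u → (0 < f.eval x * f.eval l ↔ x < α) := by
  obtain ⟨g, rfl⟩ := dvd_iff_isRoot.mpr hα
  have hg : ∀ c, l ≤ c → c ≤ u → g.eval c ≠ 0 := by
    intro c h1 h2 h3
    have hc : ((X - C α) * g).eval c = 0 := by simp [h3]
    rcases lt_trichotomy c α with h | rfl | h
    · obtain ⟨d, h4, h5, h6⟩ := hR.exists_derivative_eval_eq_zero hf h hc hα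
      exact hcrit d (h1.trans_lt h4) (h5.trans hu) h6
    · exact hcrit c hl hu (by simp [h3])
    · obtain ⟨d, h4, h5, h6⟩ := hR.exists_derivative_eval_eq_zero hf h hα hc
      exact hcrit d (hl.trans h4) (h5.trans_le h2) h6
  have hpos : ∀ x, l ≤ x → x ≤ u → 0 < g.eval x * g.eval l := by
    intro x h1 h2
    refine hR.eval_mul_pos fun c hc => ?_
    rw [Set.uIcc_of_ge h1] at hc
    exact hg c hc.1 (hc.2.trans h2)
  have hsimp : ∀ x y, ((X - C α) * g).eval x * ((X - C α) * g).eval y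
      = ((x - α) * (y - α)) * (g.eval x * g.eval y) := fun x y => by simp; ring
  refine ⟨?_, fun x h1 h2 => ?_⟩
  · rw [mul_comm, hsimp]
    exact mul_neg_of_neg_of_pos (mul_neg_of_pos_of_neg (by linarith) (by linarith))
      (hpos u (hl.trans hu).le le_rfl)
  · rw [hsimp, mul_pos_iff_of_pos_right (hpos x h1 h2)]
    refine ⟨fun h => ?_, fun h => mul_pos_of_neg_of_neg (by linarith) (by linarith)⟩
    by_contra! hc
    exact (mul_nonpos_of_nonneg_of_nonpos (sub_nonneg.mpr hc) (by linarith)).not_gt h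

end OrderedFieldCalculus

section RootTransfer

open Polynomial

variable {R : Type} [Field R] [LinearOrder R] [IsStrictOrderedRing R] {G : Type} [CommRing G]

theorem Polynomial.Monic.exists_root_bounds {p : G →+* R} {f : G[X]} (hf : f.Monic) {α : R}
    (hα : (f.map p).eval α = 0) : ∃ a b : G, p a < α ∧ α < p b := by
  let n := f.natDegree
  let M : G := 2 + ∑ i ∈ Finset.range n, (1 + f.coeff i ^ 2)
  have hM : 2 + ∑ i ∈ Finset.range n, |p (f.coeff i)| ≤ p M := by
    simp only [M, map_add, map_sum, map_pow, map_one, map_ofNat]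
    gcongr with i
    rw [← sq_abs]
    nlinarith [sq_nonneg (|p (f.coeff i)| - 1), abs_nonneg (p (f.coeff i))]
  have key : |α| < p M := by
    by_contra! hc
    have hS : 0 ≤ ∑ i ∈ Finset.range n, |p (f.coeff i)| :=
      Finset.sum_nonneg fun i _ => abs_nonneg _
    have h1 : 1 ≤ |α| := by linarith
    have hn : n ≠ 0 := by
      intro hn
      have : f = 1 := hf.natDegree_eq_zero.mp hn
      simp [this] at hα
    have hsum : α ^ n = -∑ i ∈ Finset.range n, p (f.coeff i) * α ^ i := by
      rw [hf.as_sum] at hα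
      simp [eval_finsetSum, Polynomial.map_sum] at hα
      linear_combination hα
    have h2 : |α| ^ n ≤ (∑ i ∈ Finset.range n, |p (f.coeff i)|) * |α| ^ (n - 1) := by
      rw [← abs_pow, hsum, abs_neg, Finset.sum_mul]
      refine (Finset.abs_sum_le_sum_abs _ _).trans (Finset.sum_le_sum fun i hi => ?_)
      rw [abs_mul, abs_pow]
      have : i ≤ n - 1 := by have := Finset.mem_range.mp hi; omega
      gcongr
    have h3 : |α| ^ n = |α| * |α| ^ (n - 1) := (mul_pow_sub_one hn _).symm
    rw [h3] at h2
    have h4 := le_of_mul_le_mul_right h2 (by positivity)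
    linarith
  exact ⟨-M, M, by rw [map_neg]; exact (abs_lt.mp key).1, (abs_lt.mp key).2⟩

theorem exists_isolating_interval {R : Type} [Field R] [LinearOrder R] {G : Type} [CommRing G]
    {p : G →+* R} {α : R} (hα : α ∉ Set.range p) {a b : G}
    (ha : p a < α) (hb : α < p b) (T : Finset R) (hT : ∀ c ∈ T, c ∈ Set.range p) :
    ∃ l u : G, p l < α ∧ α < p u ∧ ∀ c ∈ T, c ≤ p l ∨ p u ≤ c := by
  classical
  induction T using Finset.induction_on with
  | empty => exact ⟨a, b, ha, hb, by simp⟩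
  | insert c T _ ih =>
    obtain ⟨l, u, hl, hu, h⟩ := ih fun c hc => hT c (Finset.mem_insert_of_mem hc)
    obtain ⟨g, rfl⟩ := hT c (Finset.mem_insert_self _ _)
    simp only [Finset.mem_insert, forall_eq_or_imp]
    rcases lt_or_gt_of_ne (fun h => hα ⟨g, h⟩ : p g ≠ α) with hg | hg
    · rcases le_total (p g) (p l) with h1 | h1
      · exact ⟨l, u, hl, hu, Or.inl h1, h⟩
      · exact ⟨g, u, hg, hu, Or.inl le_rfl, fun c hc => (h c hc).imp_left h1.trans'⟩
    · rcases le_total (p u) (p g) with h1 | h1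
      · exact ⟨l, u, hl, hu, Or.inr h1, h⟩
      · exact ⟨l, g, hl, hg, Or.inr le_rfl, fun c hc => (h c hc).imp_right h1.trans⟩

variable {R' : Type} [Field R'] [LinearOrder R'] [IsStrictOrderedRing R']

theorem exists_root_same_signs (hR : PolynomialIVT R) (hR' : PolynomialIVT R')
    {p : G →+* R} {q : G →+* R'} (hp : Function.Injective p) (hq : Function.Injective q)
    (hpq : ∀ g : G, 0 < p g ↔ 0 < q g) (hinv : ∀ g : G, g ≠ 0 → ∃ g', g * g' = 1) {f : G[X]}
    (hf : f.Monic)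
    (hcp : ∀ h : G[X], h ≠ 0 → h.natDegree < f.natDegree → ∀ x, (h.map p).eval x = 0 →
      x ∈ Set.range p)
    (hcq : ∀ h : G[X], h ≠ 0 → h.natDegree < f.natDegree → ∀ x, (h.map q).eval x = 0 →
      x ∈ Set.range q)
    {α : R} (hα : (f.map p).eval α = 0) (hαp : α ∉ Set.range p) :
    ∃ β, (f.map q).eval β = 0 ∧
      ∀ h : G[X], 0 < (h.map p).eval α ↔ 0 < (h.map q).eval β := by
  have : Nontrivial G := p.domain_nontrivial
  have evp : ∀ (h : G[X]) g, (h.map p).eval (p g) = p (h.eval g) := fun h g => by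
    rw [eval_map, eval₂_at_apply]
  have evq : ∀ (h : G[X]) g, (h.map q).eval (q g) = q (h.eval g) := fun h g => by
    rw [eval_map, eval₂_at_apply]
  have hlt : ∀ a b, p a < p b ↔ q a < q b := fun a b => by
    rw [← sub_pos, ← map_sub, hpq, map_sub, sub_pos]
  have hle : ∀ a b, p a ≤ p b ↔ q a ≤ q b := fun a b => by
    rw [← not_lt, hlt, not_lt]
  have mapp0 : ∀ h : G[X], h ≠ 0 → h.map p ≠ 0 := fun h h0 =>
    (Polynomial.map_ne_zero_iff hp).mpr h0
  have mapq0 : ∀ h : G[X], h ≠ 0 → h.map q ≠ 0 := fun h h0 =>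
    (Polynomial.map_ne_zero_iff hq).mpr h0
  have hne1 : f ≠ 1 := by rintro rfl; simp at hα
  have hdeg : 0 < f.natDegree := hf.natDegree_pos.mpr hne1
  have hder : derivative f ≠ 0 := by
    intro h0
    have h1 : derivative (f.map p) = 0 := by rw [derivative_map, h0, Polynomial.map_zero]
    have h2 := derivative_eq_zero.mp h1
    rw [natDegree_map_eq_of_injective hp] at h2
    omega
  have hderdeg : (derivative f).natDegree < f.natDegree := natDegree_derivative_lt hdeg.ne'
  obtain ⟨a, b, ha, hb⟩ := hf.exists_root_bounds hα
  have roots_range : ∀ h : G[X], h ≠ 0 → h.natDegree < f.natDegree →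
      ∃ l u : G, p l < α ∧ α < p u ∧
        ∀ g, h.eval g = 0 → (p g ≤ p l ∨ p u ≤ p g) := by
    intro h h0 hd
    obtain ⟨l, u, hl, hu, H⟩ := exists_isolating_interval hαp ha hb (h.map p).roots.toFinset
      (fun c hc => hcp h h0 hd c (by simpa [mapp0 h h0] using hc))
    refine ⟨l, u, hl, hu, fun g hg => H _ ?_⟩
    simp [mapp0 h h0, evp, hg]
  obtain ⟨l, u, hl, hu, hlu⟩ := roots_range _ hder hderdeg
  have noncrit : ∀ c, p l < c → c < p u → (derivative (f.map p)).eval c ≠ 0 := by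
    intro c h1 h2 h3
    rw [derivative_map] at h3
    obtain ⟨g, rfl⟩ := hcp _ hder hderdeg c h3
    rw [evp, map_eq_zero_iff p hp] at h3
    rcases hlu g h3 with h | h
    · exact absurd h1 h.not_gt
    · exact absurd h2 h.not_gt
  have noncrit' : ∀ c, q l < c → c < q u → (derivative (f.map q)).eval c ≠ 0 := by
    intro c h1 h2 h3
    rw [derivative_map] at h3
    obtain ⟨g, rfl⟩ := hcq _ hder hderdeg c h3
    rw [evq, map_eq_zero_iff q hq] at h3
    rcases hlu g h3 with h | h
    · exact absurd h1 ((hle _ _).mp h).not_gt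
    · exact absurd h2 ((hle _ _).mp h).not_gt
  obtain ⟨hneg, hiso⟩ := hR.isolated_root (mapp0 f hf.ne_zero) hl hu hα noncrit
  have hneg' : (f.map q).eval (q l) * (f.map q).eval (q u) < 0 := by
    rw [evp, evp, ← map_mul, ← neg_pos, ← map_neg, hpq, map_neg, neg_pos, map_mul] at hneg
    rwa [evq, evq]
  obtain ⟨β, hlβ, hβu, hβ⟩ := hR' _ _ _ ((hlt l u).mp (hl.trans hu)) hneg'
  obtain ⟨-, hiso'⟩ := hR'.isolated_root (mapq0 f hf.ne_zero) hlβ hβu hβ noncrit'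
  have hcut : ∀ g, p g < α ↔ q g < β := by
    intro g
    rcases le_or_gt (p g) (p l) with h1 | h1
    · exact iff_of_true (h1.trans_lt hl) (((hle _ _).mp h1).trans_lt hlβ)
    rcases le_or_gt (p u) (p g) with h2 | h2
    · exact iff_of_false (hu.trans_le h2).not_gt (hβu.trans_le ((hle _ _).mp h2)).not_gt
    rw [← hiso _ h1.le h2.le, ← hiso' _ ((hlt _ _).mp h1).le ((hlt _ _).mp h2).le,
      evp, evp, evq, evq, ← map_mul, ← map_mul, hpq]
  have hβq : β ∉ Set.range q := by
    rintro ⟨g, rfl⟩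
    rw [evq, map_eq_zero_iff q hq] at hβ
    have h1 : p g = α := by
      have hlg : p l < p g := (hlt _ _).mpr hlβ
      have hgu : p g < p u := (hlt _ _).mpr hβu
      by_contra hne
      have h0 : (f.map p).eval (p g) = 0 := by rw [evp, hβ, map_zero]
      rcases lt_or_gt_of_ne hne with h | h
      · have := (hiso _ hlg.le hgu.le).mpr h
        rw [h0, zero_mul] at this
        exact this.false
      · obtain ⟨c, h1, h2, h3⟩ := hR.exists_derivative_eval_eq_zero (mapp0 f hf.ne_zero) h hα h0
        exact noncrit c (hl.trans h1) (h2.trans hgu) h3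
    exact hαp ⟨g, h1⟩
  have hcut' : ∀ g, α < p g ↔ β < q g := by
    intro g
    have h1 : p g ≠ α := fun h => hαp ⟨g, h⟩
    have h2 : q g ≠ β := fun h => hβq ⟨g, h⟩
    rw [← not_iff_not, not_lt, not_lt, le_iff_lt_or_eq, le_iff_lt_or_eq, hcut]
    simp [h1, h2]
  have hlow : ∀ h : G[X], h.natDegree < f.natDegree →
      (0 < (h.map p).eval α ↔ 0 < (h.map q).eval β) := by
    intro h hd
    by_cases h0 : h = 0
    · simp [h0]
    obtain ⟨l, u, hl, hu, hlu⟩ := roots_range h h0 hd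
    obtain ⟨t, ht⟩ := hinv (2 : G) (by
      intro h2
      have h3 : p 2 = p 0 := by rw [h2]
      rw [map_ofNat, map_zero] at h3
      exact two_ne_zero h3)
    have htp : p t = 2⁻¹ := eq_inv_of_mul_eq_one_right (by
      rw [← map_one p, ← ht, map_mul, map_ofNat])
    have htq : q t = 2⁻¹ := eq_inv_of_mul_eq_one_right (by
      rw [← map_one q, ← ht, map_mul, map_ofNat])
    have e1 : 0 < (h.map p).eval α * (h.map p).eval (p ((l + u) * t)) := by
      refine hR.eval_mul_pos fun c hc h3 => ?_
      have hc' : c ∈ Set.Ioo (p l) (p u) := by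
        refine Set.ordConnected_Ioo.uIcc_subset ⟨hl, hu⟩ ?_ hc
        simp only [map_mul, map_add, htp, Set.mem_Ioo]
        constructor <;> linarith
      obtain ⟨g, rfl⟩ := hcp _ h0 hd c h3
      rw [evp, map_eq_zero_iff p hp] at h3
      rcases hlu g h3 with h | h
      · exact absurd hc'.1 h.not_gt
      · exact absurd hc'.2 h.not_gt
    have e2 : 0 < (h.map q).eval β * (h.map q).eval (q ((l + u) * t)) := by
      refine hR'.eval_mul_pos fun c hc h3 => ?_
      rw [hcut] at hl
      rw [hcut'] at hu
      have hc' : c ∈ Set.Ioo (q l) (q u) := by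
        refine Set.ordConnected_Ioo.uIcc_subset ⟨hl, hu⟩ ?_ hc
        simp only [map_mul, map_add, htq, Set.mem_Ioo]
        constructor <;> linarith
      obtain ⟨g, rfl⟩ := hcq _ h0 hd c h3
      rw [evq, map_eq_zero_iff q hq] at h3
      rcases hlu g h3 with h | h
      · exact absurd hc'.1 ((hle _ _).mp h).not_gt
      · exact absurd hc'.2 ((hle _ _).mp h).not_gt
    rw [pos_iff_pos_of_mul_pos e1, pos_iff_pos_of_mul_pos e2, evp, evq, hpq]
  refine ⟨β, hβ, fun h => ?_⟩
  have h1 : (h.map p).eval α = ((h %ₘ f).map p).eval α := by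
    conv_lhs => rw [← modByMonic_add_div h f]
    simp [hα]
  have h2 : (h.map q).eval β = ((h %ₘ f).map q).eval β := by
    conv_lhs => rw [← modByMonic_add_div h f]
    simp [hβ]
  rw [h1, h2]
  exact hlow _ (natDegree_modByMonic_lt h hf hne1)

end RootTransfer

section EmbeddingTheorem

open Polynomial

variable {F R S : Type} [CommRing F] [Field R] [LinearOrder R] [Field S] [LinearOrder S]
  [Algebra F R] [Algebra F S]

/-- A subalgebra of `R × S` both of whose projections induce the same signs. -/
def Subalgebra.SameSigns (G : Subalgebra F (R × S)) : Prop :=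
  ∀ x ∈ G, 0 < x.1 ↔ 0 < x.2

theorem Subalgebra.exists_maximal_sameSigns
    (h : ∀ x : F, 0 < algebraMap F R x ↔ 0 < algebraMap F S x) :
    ∃ G : Subalgebra F (R × S), Maximal Subalgebra.SameSigns G := by
  have hbot : (⊥ : Subalgebra F (R × S)).SameSigns := by
    rintro _ ⟨x, rfl⟩
    exact h x
  refine (zorn_le_nonempty₀ {G : Subalgebra F (R × S) | G.SameSigns}
    (fun c hc hchain y hy => ?_) ⊥ hbot).imp fun _ h => h.2
  refine ⟨sSup c, fun x hx => ?_, fun z hz => le_sSup hz⟩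
  have : Nonempty c := ⟨⟨y, hy⟩⟩
  rw [sSup_eq_iSup', ← SetLike.mem_coe,
    Subalgebra.coe_iSup_of_directed hchain.directedOn.directed_val] at hx
  obtain ⟨T, hxT⟩ := Set.mem_iUnion.mp hx
  exact hc T.2 x hxT

variable {G : Subalgebra F (R × S)}

theorem Subalgebra.SameSigns.fst_injective [IsStrictOrderedRing S] (hG : G.SameSigns) :
    Function.Injective ((RingHom.fst R S).comp G.val.toRingHom) := by
  rw [injective_iff_map_eq_zero]
  rintro ⟨⟨a, b⟩, hx⟩ (h : a = 0)
  have h1 := hG _ hx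
  have h2 := hG _ (neg_mem hx)
  simp only [h, lt_irrefl, false_iff, not_lt, Prod.fst_neg, Prod.snd_neg, neg_zero] at h1 h2
  exact Subtype.ext (Prod.ext h (le_antisymm h1 (neg_nonpos.mp h2)))

theorem Subalgebra.SameSigns.snd_injective [IsStrictOrderedRing R] (hG : G.SameSigns) :
    Function.Injective ((RingHom.snd R S).comp G.val.toRingHom) := by
  rw [injective_iff_map_eq_zero]
  rintro ⟨⟨a, b⟩, hx⟩ (h : b = 0)
  have h1 := hG _ hx
  have h2 := hG _ (neg_mem hx)
  simp only [h, lt_irrefl, iff_false, not_lt, Prod.fst_neg, Prod.snd_neg, neg_zero] at h1 h2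
  exact Subtype.ext (Prod.ext (le_antisymm h1 (neg_nonpos.mp h2)) h)

theorem Subalgebra.mem_of_maximal_sameSigns (hG : Maximal Subalgebra.SameSigns G) {α : R} {β : S}
    (h : ∀ f : G[X], 0 < (f.map ((RingHom.fst R S).comp G.val.toRingHom)).eval α ↔
      0 < (f.map ((RingHom.snd R S).comp G.val.toRingHom)).eval β) :
    (α, β) ∈ G := by
  let φ : G →+* R × S := G.val.toRingHom
  let G' : Subalgebra F (R × S) :=
    { (eval₂RingHom φ (α, β)).range.toSubsemiring with
      algebraMap_mem' := fun r => ⟨C (algebraMap F G r), eval₂_C φ (α, β)⟩ }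
  have hle : G ≤ G' := fun x hx => ⟨C ⟨x, hx⟩, eval₂_C φ (α, β)⟩
  refine hG.2 (y := G') ?_ hle ⟨X, eval₂_X φ (α, β)⟩
  rintro _ ⟨f, rfl⟩
  have h3 := h f
  rw [eval_map, eval_map] at h3
  have h1 : (eval₂ φ (α, β) f).1 = _ := hom_eval₂ f φ (RingHom.fst R S) (α, β)
  have h2 : (eval₂ φ (α, β) f).2 = _ := hom_eval₂ f φ (RingHom.snd R S) (α, β)
  rw [coe_eval₂RingHom, h1, h2]
  exact h3

variable [IsStrictOrderedRing R] [IsStrictOrderedRing S]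

theorem Polynomial.eval_inv_pos_iff {E : Type} [CommRing E] {p : E →+* R} {a : E}
    (ha : p a ≠ 0) (f : E[X]) :
    0 < (f.map p).eval (p a)⁻¹ ↔ 0 < p ((f.reverse * X ^ f.natDegree).eval a) := by
  let : Invertible (p a)⁻¹ := invertibleOfNonzero (inv_ne_zero ha)
  have h1 := eval₂_reverse_mul_pow p (p a)⁻¹ f
  rw [invOf_eq_inv, inv_inv] at h1
  rw [eval_map, ← h1, eval_mul, map_mul, eval_pow, eval_X, map_pow, ← eval₂_at_apply]
  have h2 : 0 < (p a ^ f.natDegree) ^ 2 := by positivity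
  have h3 : eval₂ p (p a) f.reverse * p a ^ f.natDegree
      = eval₂ p (p a) f.reverse * (p a)⁻¹ ^ f.natDegree * (p a ^ f.natDegree) ^ 2 := by
    rw [inv_pow, sq, ← mul_assoc, inv_mul_cancel_right₀ (pow_ne_zero _ ha)]
  rw [h3, mul_pos_iff_of_pos_right h2]

theorem Subalgebra.exists_mul_eq_one_of_maximal_sameSigns
    (hG : Maximal Subalgebra.SameSigns G) (g : G) (hg : g ≠ 0) : ∃ g' : G, g * g' = 1 := by
  have hp : g.1.1 ≠ 0 := fun h => hg (hG.1.fst_injective (by simpa using h))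
  have hq : g.1.2 ≠ 0 := fun h => hg (hG.1.snd_injective (by simpa using h))
  refine ⟨⟨(g.1.1⁻¹, g.1.2⁻¹), mem_of_maximal_sameSigns hG fun f => ?_⟩, ?_⟩
  · refine (eval_inv_pos_iff (p := (RingHom.fst R S).comp G.val.toRingHom) hp f).trans
      (Iff.trans ?_
      (eval_inv_pos_iff (p := (RingHom.snd R S).comp G.val.toRingHom) hq f).symm)
    exact hG.1 _ (Subtype.prop _)
  · exact Subtype.ext (Prod.ext (mul_inv_cancel₀ hp) (mul_inv_cancel₀ hq))

theorem Subalgebra.root_mem_range_of_maximal_sameSigns (hR : PolynomialIVT R)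
    (hS : PolynomialIVT S) (hG : Maximal Subalgebra.SameSigns G) (f : G[X]) (hf : f ≠ 0) :
    (∀ x, (f.map ((RingHom.fst R S).comp G.val.toRingHom)).eval x = 0 →
      x ∈ Set.range ((RingHom.fst R S).comp G.val.toRingHom)) ∧
    (∀ x, (f.map ((RingHom.snd R S).comp G.val.toRingHom)).eval x = 0 →
      x ∈ Set.range ((RingHom.snd R S).comp G.val.toRingHom)) := by
  induction hd : f.natDegree using Nat.strong_induction_on generalizing f with
  | _ d ih =>
  have hinv := exists_mul_eq_one_of_maximal_sameSigns hG
  have : IsDomain G := hG.1.fst_injective.isDomain _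
  wlog hmon : f.Monic generalizing f
  · obtain ⟨c, hc⟩ := hinv f.leadingCoeff (leadingCoeff_ne_zero.mpr hf)
    have hc0 : c ≠ 0 := by rintro rfl; simp at hc
    have hm : (C c * f).Monic := by
      rw [Monic, leadingCoeff_mul, leadingCoeff_C, mul_comm, hc]
    obtain ⟨h1, h2⟩ := this (C c * f) hm.ne_zero (by rw [natDegree_C_mul hc0, hd]) hm
    exact ⟨fun x hx => h1 x (by rw [Polynomial.map_mul, eval_mul, hx, mul_zero]),
      fun x hx => h2 x (by rw [Polynomial.map_mul, eval_mul, hx, mul_zero])⟩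
  have hsgn : ∀ g : G, 0 < ((RingHom.fst R S).comp G.val.toRingHom) g ↔
      0 < ((RingHom.snd R S).comp G.val.toRingHom) g := fun g => hG.1 g g.2
  have ih1 := fun (h : G[X]) (h0 : h ≠ 0) (hlt : h.natDegree < f.natDegree) =>
    (ih h.natDegree (hd ▸ hlt) h h0 rfl).1
  have ih2 := fun (h : G[X]) (h0 : h ≠ 0) (hlt : h.natDegree < f.natDegree) =>
    (ih h.natDegree (hd ▸ hlt) h h0 rfl).2
  constructor
  · intro x hx
    by_contra hxr
    obtain ⟨y, -, hy⟩ := exists_root_same_signs hR hS hG.1.fst_injective hG.1.snd_injective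
      hsgn hinv hmon ih1 ih2 hx hxr
    exact hxr ⟨⟨(x, y), mem_of_maximal_sameSigns hG hy⟩, rfl⟩
  · intro y hy
    by_contra hyr
    obtain ⟨x, -, hx⟩ := exists_root_same_signs hS hR hG.1.snd_injective hG.1.fst_injective
      (fun g => (hsgn g).symm) hinv hmon ih2 ih1 hy hyr
    exact hyr ⟨⟨(x, y), mem_of_maximal_sameSigns hG fun h => (hx h).symm⟩, rfl⟩

/-- Two ordered fields with the intermediate value property that induce the same signs on a ring
`F` have order-isomorphic algebraic closures of `F`, in the form of a correspondence `G`. -/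
theorem PolynomialIVT.exists_correspondence (hR : PolynomialIVT R) (hS : PolynomialIVT S)
    (h : ∀ x : F, 0 < algebraMap F R x ↔ 0 < algebraMap F S x) :
    ∃ G : Subalgebra F (R × S), G.SameSigns ∧
      ∀ α : R, (∃ f : F[X], f.map (algebraMap F R) ≠ 0 ∧ aeval α f = 0) →
        ∃ β, (α, β) ∈ G := by
  obtain ⟨G, hG⟩ := Subalgebra.exists_maximal_sameSigns h
  refine ⟨G, hG.1, fun α ⟨f, hf, hfα⟩ => ?_⟩
  have hmap : (f.map (algebraMap F G)).map ((RingHom.fst R S).comp G.val.toRingHom)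
      = f.map (algebraMap F R) := by
    rw [Polynomial.map_map]
    rfl
  obtain ⟨⟨⟨a, β⟩, hβ⟩, rfl⟩ := (Subalgebra.root_mem_range_of_maximal_sameSigns hR hS hG
    (f.map (algebraMap F G)) (fun h0 => hf (by rw [← hmap, h0, Polynomial.map_zero]))).1 α
    (by rw [hmap, eval_map_algebraMap, hfα])
  exact ⟨β, hβ⟩

end EmbeddingTheorem

section RealClosure

open Polynomial

theorem IsFormallyRealField.exists_realClosed_extension {E : Type} [Field E]
    (hE : IsFormallyRealField E) :
    ∃ (M : Type) (_ : Field M) (_ : Algebra E M), Algebra.IsAlgebraic E M ∧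
      IsRealClosedField M := by
  let A := AlgebraicClosure E
  obtain ⟨M, -, hM⟩ := zorn_le_nonempty₀ {M : IntermediateField E A | IsFormallyRealField M}
    (fun c hc hchain y hy => by
      refine ⟨sSup c, ?_, fun z hz => le_sSup hz⟩
      have : Nonempty c := ⟨⟨y, hy⟩⟩
      have hmem : ∀ a, a ∈ sSup c → ∃ T ∈ c, a ∈ T := by
        intro a ha
        rw [sSup_eq_iSup', ← SetLike.mem_coe,
          IntermediateField.coe_iSup_of_directed hchain.directedOn.directed_val] at ha
        obtain ⟨T, hT⟩ := Set.mem_iUnion.mp ha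
        exact ⟨T, T.2, hT⟩
      have key : ∀ x : ↥(sSup c), IsSumSq x →
          ∃ T ∈ c, ∃ y : T, IsSumSq y ∧ (y : A) = x := by
        intro x hx
        induction hx with
        | zero => exact ⟨y, hy, 0, IsSumSq.zero, rfl⟩
        | sq_add a _ ih =>
          obtain ⟨T, hT, z, hz, hz'⟩ := ih
          obtain ⟨T', hT', ha⟩ := hmem a a.2
          obtain ⟨U, hU, h1, h2⟩ := hchain.directedOn T hT T' hT'
          refine ⟨U, hU, ⟨a, h2 ha⟩ * ⟨a, h2 ha⟩ + ⟨z, h1 z.2⟩, IsSumSq.sq_add _ ?_, ?_⟩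
          · exact hz.map_ringHom (IntermediateField.inclusion h1).toRingHom
          · simp [← hz']
      intro h
      obtain ⟨T, hT, z, hz, hz'⟩ := key _ h
      have hz1 : z = -1 := Subtype.ext hz'
      exact hc hT (hz1 ▸ hz))
    ⊥ (IsFormallyRealField.of_ringHom (IntermediateField.botEquiv E A).toRingEquiv.toRingHom hE)
  refine ⟨M, inferInstance, inferInstance, inferInstance, hM.1, fun N _ _ _ hN y => ?_⟩
  let φ : N →ₐ[M] A := IsAlgClosed.lift
  have hle : M ≤ φ.fieldRange.restrictScalars E := fun a ha =>
    ⟨algebraMap M N ⟨a, ha⟩, φ.commutes ⟨a, ha⟩⟩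
  have hreal : IsFormallyRealField (φ.fieldRange.restrictScalars E) :=
    IsFormallyRealField.of_ringHom (AlgEquiv.ofInjectiveField φ).symm.toRingEquiv.toRingHom hN
  have hy : φ y ∈ M := hM.2 hreal hle ⟨y, rfl⟩
  exact ⟨⟨φ y, hy⟩, φ.injective (φ.commutes _)⟩

theorem PolynomialIVT.of_algebraicallyClosedIn {F N : Type} [Field F] [LinearOrder F]
    [Field N] [LinearOrder N] [Algebra F N]
    (hpos : ∀ x y : F, x < y ↔ algebraMap F N x < algebraMap F N y) (hN : PolynomialIVT N)
    (h : ∀ y : N, IsAlgebraic F y → y ∈ Set.range (algebraMap F N)) : PolynomialIVT F := by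
  intro f a b hab hf
  have ev : ∀ x, (f.map (algebraMap F N)).eval (algebraMap F N x) = algebraMap F N (f.eval x) :=
    fun x => by rw [eval_map, eval₂_at_apply]
  have hf0 : f ≠ 0 := by
    rintro rfl
    simp at hf
  obtain ⟨c, h1, h2, h3⟩ := hN (f.map (algebraMap F N)) _ _ ((hpos a b).mp hab) (by
    rw [ev, ev, ← map_mul, ← map_zero (algebraMap F N)]
    exact (hpos _ _).mp hf)
  obtain ⟨c, rfl⟩ := h c ⟨f, hf0, by rwa [← eval_map_algebraMap]⟩
  refine ⟨c, (hpos _ _).mpr h1, (hpos _ _).mpr h2, ?_⟩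
  rwa [ev, map_eq_zero] at h3

theorem PolynomialIVT.map_pos_iff {F M : Type} [Field F] [LinearOrder F] [IsStrictOrderedRing F]
    [Field M] [LinearOrder M] [IsStrictOrderedRing M] (hF : PolynomialIVT F) (φ : F →+* M) (x : F) :
    0 < φ x ↔ 0 < x := by
  have key : ∀ x, 0 < x → 0 < φ x := by
    intro x hx
    obtain ⟨y, rfl⟩ := hF.isSquare_of_nonneg hx.le
    rw [map_mul]
    exact mul_self_pos.mpr (by rw [Ne, map_eq_zero]; rintro rfl; simp at hx)
  refine ⟨fun h => ?_, key x⟩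
  rcases lt_trichotomy 0 x with h1 | rfl | h1
  · exact h1
  · simp at h
  · have := key (-x) (neg_pos.mpr h1)
    rw [map_neg, neg_pos] at this
    exact absurd h this.not_gt

theorem PolynomialIVT.isRealClosedField {F : Type} [Field F] [LinearOrder F]
    [IsStrictOrderedRing F] (hF : PolynomialIVT F) : IsRealClosedField F := by
  refine ⟨fun h => (neg_one_lt_zero (R := F)).not_ge h.nonneg, fun E _ _ _ hE e => ?_⟩
  obtain ⟨M, _, _, _, hM⟩ := hE.exists_realClosed_extension
  obtain ⟨_, _⟩ := hM.exists_linearOrder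
  let : Algebra F M := ((algebraMap E M).comp (algebraMap F E)).toAlgebra
  have : IsScalarTower F E M := IsScalarTower.of_algebraMap_eq fun _ => rfl
  obtain ⟨G, hG, hGα⟩ := hM.polynomialIVT.exists_correspondence hF
    (fun x : F => hF.map_pos_iff (algebraMap F M) x)
  obtain ⟨f, hf0, hf⟩ := Algebra.IsAlgebraic.isAlgebraic (R := F) e
  obtain ⟨β, hβ⟩ := hGα (algebraMap E M e) ⟨f, (Polynomial.map_ne_zero_iff
    (algebraMap F M).injective).mpr hf0, by rw [aeval_algebraMap_apply, hf, map_zero]⟩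
  have h1 := hG.snd_injective (a₁ := ⟨_, hβ⟩) (a₂ := ⟨_, G.algebraMap_mem β⟩) rfl
  have h2 : algebraMap E M e = algebraMap F M β := congrArg (fun z : G => z.1.1) h1
  exact ⟨β, (algebraMap E M).injective (by rw [h2]; rfl)⟩

end RealClosure

section ArtinLang

open Polynomial

theorem IsRealClosedField.mem_range_of_isAlgebraic {k N : Type} [Field k] [Field N] [Algebra k N]
    (hk : IsRealClosedField k) (hN : IsFormallyRealField N) {y : N} (hy : IsAlgebraic k y) :
    y ∈ Set.range (algebraMap k N) := by
  let E := IntermediateField.adjoin k {y}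
  have hE : Algebra.IsAlgebraic k E := IntermediateField.isAlgebraic_adjoin_simple hy.isIntegral
  obtain ⟨x, hx⟩ := hk.2 E hE (IsFormallyRealField.of_ringHom (algebraMap E N) hN)
    ⟨y, IntermediateField.mem_adjoin_simple_self k y⟩
  exact ⟨x, congrArg Subtype.val hx⟩

theorem LinearOrder.isFormallyRealField (F : Type) [Field F] [LinearOrder F]
    [IsStrictOrderedRing F] : IsFormallyRealField F :=
  fun h => (neg_one_lt_zero (R := F)).not_ge h.nonneg

open Filter in
theorem PolynomialIVT.germ {ι k : Type} [Field k] [LinearOrder k] [IsStrictOrderedRing k]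
    (hk : PolynomialIVT k) (U : Ultrafilter ι) : PolynomialIVT (Germ (U : Filter ι) k) := by
  intro f a b hab hf
  induction a using Germ.inductionOn with | _ a =>
  induction b using Germ.inductionOn with | _ b =>
  obtain ⟨f, rfl⟩ := map_surjective (Germ.coeRingHom (U : Filter ι) (R := k))
    Quotient.mk''_surjective f
  have ev : ∀ x : ι → k, (f.map (Germ.coeRingHom (U : Filter ι))).eval (x : Germ (U : Filter ι) k)
      = ((fun i => (f.map (Pi.evalRingHom (fun _ => k) i)).eval (x i) : ι → k) :
        Germ (U : Filter ι) k) := by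
    intro x
    have h1 : (fun i => (f.map (Pi.evalRingHom (fun _ => k) i)).eval (x i)) = f.eval x := by
      funext i
      rw [eval_map]
      exact eval₂_at_apply (Pi.evalRingHom (fun _ => k) i) x
    rw [h1, eval_map]
    exact eval₂_at_apply (Germ.coeRingHom (U : Filter ι)) x
  have h0 : ∀ x : ι → k, (x : Germ (U : Filter ι) k) < 0 ↔ ∀ᶠ i in (U : Filter ι), x i < 0 :=
    fun x => Germ.coe_lt
  rw [ev, ev, ← Germ.coe_mul, h0] at hf
  rw [Germ.coe_lt] at hab
  have hc : ∀ᶠ i in (U : Filter ι), ∃ c, a i < c ∧ c < b i ∧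
      (f.map (Pi.evalRingHom (fun _ => k) i)).eval c = 0 := by
    filter_upwards [hab, hf] with i h1 h2 using hk _ _ _ h1 h2
  obtain ⟨c, hc⟩ := hc.choice
  refine ⟨c, Germ.coe_lt.mpr (hc.mono fun i h => h.1), Germ.coe_lt.mpr (hc.mono fun i h => h.2.1),
    ?_⟩
  rw [ev]
  exact Germ.coe_eq.mpr (hc.mono fun i h => h.2.2)

variable {k N : Type} [Field k] [LinearOrder k] [IsStrictOrderedRing k]
  [Field N] [LinearOrder N] [IsStrictOrderedRing N] [Algebra k N]

theorem PolynomialIVT.exists_eval_pos_iff (hk : PolynomialIVT k) (hN : PolynomialIVT N) (t : N)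
    (T : Finset k[X]) : ∃ a : k, ∀ g ∈ T, 0 < g.eval a ↔ 0 < aeval t g := by
  classical
  have hlt : ∀ x y : k, algebraMap k N x < algebraMap k N y ↔ x < y := fun x y => by
    rw [← sub_pos, ← map_sub, hk.map_pos_iff, sub_pos]
  by_cases ht : t ∈ Set.range (algebraMap k N)
  · obtain ⟨a, rfl⟩ := ht
    refine ⟨a, fun g _ => ?_⟩
    rw [aeval_algebraMap_apply_eq_algebraMap_eval, hk.map_pos_iff]
  let Z : Finset k := T.biUnion fun g => g.roots.toFinset
  obtain ⟨a, h1, h2⟩ := Order.exists_between_finsets (Z.filter (algebraMap k N · < t))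
    (Z.filter (t < algebraMap k N ·)) (fun x hx y hy => by
      rw [Finset.mem_filter] at hx hy
      exact (hlt x y).mp (hx.2.trans hy.2))
  refine ⟨a, fun g hg => ?_⟩
  by_cases hg0 : g = 0
  · simp [hg0]
  have key : 0 < (g.map (algebraMap k N)).eval t * (g.map (algebraMap k N)).eval
      (algebraMap k N a) := by
    refine hN.eval_mul_pos fun c hc h => ?_
    obtain ⟨c, rfl⟩ := hk.isRealClosedField.mem_range_of_isAlgebraic
      (LinearOrder.isFormallyRealField N) (y := c) ⟨g, hg0, by rwa [← eval_map_algebraMap]⟩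
    have hcZ : c ∈ Z := by
      rw [eval_map, eval₂_at_apply, map_eq_zero] at h
      exact Finset.mem_biUnion.mpr ⟨g, hg, by simpa [hg0] using h⟩
    rcases lt_trichotomy (algebraMap k N c) t with h3 | h3 | h3
    · have := (hlt _ _).mpr (h1 c (Finset.mem_filter.mpr ⟨hcZ, h3⟩))
      exact (lt_min h3 this).not_ge hc.1
    · exact ht ⟨c, h3⟩
    · have := (hlt _ _).mpr (h2 c (Finset.mem_filter.mpr ⟨hcZ, h3⟩))
      exact (max_lt h3 this).not_ge hc.2
  rw [eval_map_algebraMap, eval_map_algebraMap, aeval_algebraMap_apply_eq_algebraMap_eval] at key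
  rw [pos_iff_pos_of_mul_pos key, hk.map_pos_iff]

open Filter in
theorem PolynomialIVT.exists_specialization_of_isAlgebraic (hk : PolynomialIVT k)
    (hN : PolynomialIVT N) (t : N) {σ : Type} [Finite σ] (s : σ → N)
    (hs : ∀ i, ∃ f : k[X][X], f.map (aeval (R := k) t).toRingHom ≠ 0 ∧
      f.eval₂ (aeval (R := k) t).toRingHom (s i) = 0) :
    ∃ s' : σ → k, ∀ P : MvPolynomial σ k, MvPolynomial.aeval s P = 0 →
      MvPolynomial.eval s' P = 0 := by
  choose a ha using hk.exists_eval_pos_iff hN t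
  let U : Ultrafilter (Finset k[X]) := Ultrafilter.of atTop
  have hU : (U : Filter (Finset k[X])) ≤ atTop := Ultrafilter.of_le atTop
  let S := Germ (U : Filter (Finset k[X])) k
  let φ : k[X] →+* S := (Germ.coeRingHom (U : Filter (Finset k[X]))).comp
    (RingHom.pi fun T => evalRingHom (a T))
  let : Algebra k[X] N := (aeval (R := k) t).toRingHom.toAlgebra
  let : Algebra k[X] S := φ.toAlgebra
  have hsign : ∀ g : k[X], 0 < algebraMap k[X] N g ↔ 0 < algebraMap k[X] S g := by
    intro g
    have h1 : ∀ᶠ T in (U : Filter (Finset k[X])), (0 < g.eval (a T) ↔ 0 < aeval t g) :=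
      hU ((eventually_ge_atTop {g}).mono fun T hT => ha T g (hT (Finset.mem_singleton_self g)))
    have h2 : 0 < algebraMap k[X] S g ↔ ∀ᶠ T in (U : Filter (Finset k[X])), 0 < g.eval (a T) :=
      Germ.coe_pos
    rw [h2, eventually_congr h1, eventually_const]
    rfl
  obtain ⟨G, hG, hGs⟩ := hN.exists_correspondence (hk.germ U) hsign
  choose β hβ using fun i => hGs (s i) (hs i)
  choose b hb using fun i => Quotient.mk''_surjective (β i)
  have key : ∀ P : MvPolynomial σ k, MvPolynomial.aeval s P = 0 →
      ∀ᶠ T in (U : Filter (Finset k[X])), MvPolynomial.eval (fun i => b i T) P = 0 := by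
    intro P hP
    let z : G := P.eval₂ ((algebraMap k[X] G).comp C) fun i => ⟨(s i, β i), hβ i⟩
    have hz : z = 0 := by
      refine hG.fst_injective ?_
      rw [map_zero, MvPolynomial.eval₂_comp_left, ← hP, MvPolynomial.aeval_def]
      congr 1
      ext x
      exact aeval_C t x
    have h1 : ((RingHom.snd N S).comp G.val.toRingHom) z = 0 := by rw [hz, map_zero]
    have h2 : ((RingHom.snd N S).comp G.val.toRingHom) z
        = Germ.coeRingHom (U : Filter (Finset k[X]))
          (P.eval₂ (RingHom.pi fun _ => RingHom.id k) b) := by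
      rw [MvPolynomial.eval₂_comp_left, MvPolynomial.eval₂_comp_left]
      have h3 : (((RingHom.snd N S).comp G.val.toRingHom).comp ((algebraMap k[X] G).comp C))
          = (Germ.coeRingHom (U : Filter (Finset k[X]))).comp
            (RingHom.pi fun _ => RingHom.id k) := by
        ext x
        change φ (C x) = _
        exact congrArg (Germ.coeRingHom (U : Filter (Finset k[X]))) (funext fun T => eval_C)
      rw [h3]
      congr 1
      funext i
      exact (hb i).symm
    rw [h2] at h1
    refine (Germ.coe_eq.mp h1).mono fun T hT => ?_
    have h4 := MvPolynomial.eval₂_comp_left (Pi.evalRingHom (fun _ : Finset k[X] => k) T)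
      (RingHom.pi fun _ => RingHom.id k) b P
    exact h4.symm.trans hT
  let I : Ideal (MvPolynomial σ k) := RingHom.ker (MvPolynomial.aeval (R := k) s)
  obtain ⟨B, hB⟩ : I.FG := IsNoetherian.noetherian I
  have hev : ∀ᶠ T in (U : Filter (Finset k[X])), ∀ P ∈ B,
      MvPolynomial.eval (fun i => b i T) P = 0 :=
    (eventually_all_finset B).mpr fun P hP => key P (by
      have : P ∈ I := hB ▸ Ideal.subset_span hP
      exact this)
  obtain ⟨T, hT⟩ := hev.exists
  refine ⟨fun i => b i T, fun P hP => ?_⟩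
  have hle : I ≤ RingHom.ker (MvPolynomial.eval fun i => b i T) := by
    rw [← hB]
    exact Ideal.span_le.mpr hT
  exact hle hP

end ArtinLang

section Specialization

open Polynomial

open IntermediateField IntermediateField.algebraAdjoinAdjoin in
theorem exists_polynomial_polynomial_eval₂_eq_zero {k N : Type} [Field k] [Field N] [Algebra k N]
    (t : N) {y : N} (hy : IsAlgebraic (IntermediateField.adjoin k {t}) y) :
    ∃ f : k[X][X], f.map (aeval (R := k) t).toRingHom ≠ 0 ∧
      f.eval₂ (aeval (R := k) t).toRingHom y = 0 := by
  rw [← IsFractionRing.isAlgebraic_iff (Algebra.adjoin k {t})] at hy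
  obtain ⟨g, hg0, hg⟩ := hy
  have hsurj : Function.Surjective ((aeval (R := k) t).toRingHom.codRestrict
      (Algebra.adjoin k {t}) fun x => by
        rw [Algebra.adjoin_singleton_eq_range_aeval]
        exact ⟨x, rfl⟩) := by
    rintro ⟨x, hx⟩
    rw [Algebra.adjoin_singleton_eq_range_aeval] at hx
    obtain ⟨f, rfl⟩ := hx
    exact ⟨f, rfl⟩
  obtain ⟨f, rfl⟩ := map_surjective _ hsurj g
  refine ⟨f, fun h => hg0 ?_, ?_⟩
  · refine map_injective (algebraMap (Algebra.adjoin k {t}) N)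
      (FaithfulSMul.algebraMap_injective _ _) ?_
    rw [Polynomial.map_map, Polynomial.map_zero]
    exact h
  · rw [aeval_def, eval₂_map] at hg
    exact hg

theorem PolynomialIVT.exists_specialization_fin (m : ℕ) :
    ∀ (k N : Type) [Field k] [LinearOrder k] [IsStrictOrderedRing k]
    [Field N] [LinearOrder N] [IsStrictOrderedRing N] [Algebra k N],
    PolynomialIVT k → PolynomialIVT N → ∀ s : Fin m → N,
    ∃ s' : Fin m → k, ∀ P : MvPolynomial (Fin m) k, MvPolynomial.aeval s P = 0 →
      MvPolynomial.eval s' P = 0 := by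
  induction m with
  | zero =>
    intro k N _ _ _ _ _ _ _ _ _ s
    refine ⟨Fin.elim0, fun P hP => ?_⟩
    obtain ⟨c, rfl⟩ := MvPolynomial.C_surjective (Fin 0) P
    simpa using hP
  | succ m ih =>
    intro k N _ _ _ _ _ _ _ hk hN s
    let E := IntermediateField.adjoin k {s 0}
    let k' := algebraicClosure E N
    have hk' : PolynomialIVT k' := PolynomialIVT.of_algebraicallyClosedIn (N := N)
      (fun _ _ => Iff.rfl) hN (fun y hy => by
        have : IsAlgebraic E y := hy.restrictScalars E
        exact ⟨⟨y, mem_algebraicClosure_iff.mpr this⟩, rfl⟩)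
    obtain ⟨r, hr⟩ := ih k' N hk' hN (fun i => s i.succ)
    obtain ⟨s', hs'⟩ := hk.exists_specialization_of_isAlgebraic hN (s 0)
      (Fin.cons (s 0) fun i => (r i : N) : Fin (m + 1) → N) (fun i => by
        apply exists_polynomial_polynomial_eval₂_eq_zero
        refine Fin.cases ?_ (fun i => ?_) i
        · exact isAlgebraic_algebraMap (⟨s 0, IntermediateField.mem_adjoin_simple_self k _⟩ : E)
        · exact mem_algebraicClosure_iff.mp (r i).2)
    refine ⟨s', fun P hP => hs' P ?_⟩
    let t : k' := algebraMap E k' ⟨s 0, IntermediateField.mem_adjoin_simple_self k _⟩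
    let Q : MvPolynomial (Fin m) k' := P.eval₂
      (MvPolynomial.C.comp ((algebraMap E k').comp (algebraMap k E)))
      (Fin.cons (MvPolynomial.C t) MvPolynomial.X)
    have hQ : ∀ v : Fin m → N, MvPolynomial.aeval v Q
        = MvPolynomial.aeval (Fin.cons (s 0) v : Fin (m + 1) → N) P := by
      intro v
      have h1 := MvPolynomial.eval₂_comp_left (MvPolynomial.aeval (R := k') v).toRingHom
        (MvPolynomial.C.comp ((algebraMap E k').comp (algebraMap k E)))
        (Fin.cons (MvPolynomial.C t) MvPolynomial.X) P
      refine h1.trans ?_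
      rw [MvPolynomial.aeval_def]
      congr 1
      · ext x
        exact MvPolynomial.aeval_C _ _
      · funext i
        refine Fin.cases ?_ (fun i => ?_) i
        · exact MvPolynomial.aeval_C _ _
        · exact MvPolynomial.aeval_X _ _
    have h1 := hr Q (by rw [hQ, ← hP]; congr; exact Fin.cons_self_tail s)
    rw [← hQ]
    have h2 := MvPolynomial.aeval_algebraMap_apply N r Q
    refine h2.trans ?_
    rw [MvPolynomial.aeval_eq_eval, h1, map_zero]

theorem PolynomialIVT.exists_specialization {k N : Type} [Field k] [LinearOrder k]
    [IsStrictOrderedRing k] [Field N] [LinearOrder N] [IsStrictOrderedRing N] [Algebra k N]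
    (hk : PolynomialIVT k) (hN : PolynomialIVT N) {σ : Type} [Finite σ] (s : σ → N) :
    ∃ s' : σ → k, ∀ P : MvPolynomial σ k, MvPolynomial.aeval s P = 0 →
      MvPolynomial.eval s' P = 0 := by
  obtain ⟨m, ⟨e⟩⟩ := Finite.exists_equiv_fin σ
  obtain ⟨s', hs'⟩ := exists_specialization_fin m k N hk hN (s ∘ e.symm)
  refine ⟨s' ∘ e, fun P hP => ?_⟩
  rw [← MvPolynomial.eval_rename]
  refine hs' _ ?_
  rw [MvPolynomial.aeval_rename, Function.comp_assoc, e.symm_comp_self, Function.comp_id, hP]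

/-- An invertible matrix over a real closed extension `N` of a real closed field `k` specializes
to an invertible matrix over `k`. -/
theorem IsRealClosedField.exists_matrix_specialization {k N : Type} [Field k] [Field N]
    [Algebra k N] (hk : IsRealClosedField k) (hN : IsRealClosedField N) {n : ℕ}
    (M : Matrix (Fin n) (Fin n) N) (hM : IsUnit M.det) :
    ∃ M' : Matrix (Fin n) (Fin n) k, IsUnit M'.det ∧
      ∀ P : MvPolynomial (Fin n × Fin n) k, MvPolynomial.aeval (fun q => M q.1 q.2) P = 0 →
        MvPolynomial.eval (fun q => M' q.1 q.2) P = 0 := by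
  obtain ⟨_, _⟩ := hk.exists_linearOrder
  obtain ⟨_, _⟩ := hN.exists_linearOrder
  obtain ⟨s, hs⟩ := hk.polynomialIVT.exists_specialization hN.polynomialIVT
    (fun o : Option (Fin n × Fin n) => o.elim M.det⁻¹ fun q => M q.1 q.2)
  refine ⟨Matrix.of fun i j => s (some (i, j)), ?_, fun P hP => ?_⟩
  · have h1 := hs (MvPolynomial.X none *
      (Matrix.of fun i j => MvPolynomial.X (some (i, j))).det - 1) (by
        simp only [map_sub, map_mul, MvPolynomial.aeval_X, map_one, AlgHom.map_det]
        have : (MvPolynomial.aeval fun o : Option (Fin n × Fin n) =>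
            o.elim M.det⁻¹ fun q => M q.1 q.2).mapMatrix
            (Matrix.of fun i j => MvPolynomial.X (R := k) (some (i, j))) = M := by
          ext i j
          simp
        rw [this]
        simp [hM.ne_zero])
    simp only [map_sub, map_mul, MvPolynomial.eval_X, map_one, RingHom.map_det] at h1
    have h2 : (MvPolynomial.eval s).mapMatrix
        (Matrix.of fun i j => MvPolynomial.X (R := k) (some (i, j)))
        = Matrix.of fun i j => s (some (i, j)) := by
      ext i j
      simp
    rw [h2] at h1
    exact IsUnit.of_mul_eq_one_right (s none) (sub_eq_zero.mp h1)
  · have h1 := hs (MvPolynomial.rename some P) (by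
      rw [MvPolynomial.aeval_rename]
      exact hP)
    rw [MvPolynomial.eval_rename] at h1
    exact h1

end Specialization

section RelativeClosure

theorem IsRealClosedField.of_relative_algebraicClosure {K K₁ N : Type} [Field K] [Field K₁]
    [Field N] [Algebra K K₁] [Algebra K₁ N] [Algebra K N] [IsScalarTower K K₁ N]
    (hN : IsRealClosedField N)
    (hK₁ : ∀ x : N, x ∈ Set.range (algebraMap K₁ N) ↔ IsAlgebraic K x) :
    IsRealClosedField K₁ ∧ Algebra.IsAlgebraic K K₁ := by
  have hinj : Function.Injective (algebraMap K₁ N) := (algebraMap K₁ N).injective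
  have halg : Algebra.IsAlgebraic K K₁ :=
    ⟨fun x => (isAlgebraic_algebraMap_iff hinj).1 ((hK₁ _).1 ⟨x, rfl⟩)⟩
  refine ⟨?_, halg⟩
  obtain ⟨_, _⟩ := hN.exists_linearOrder
  let lo : LinearOrder K₁ := LinearOrder.lift' (algebraMap K₁ N) hinj
  have : IsStrictOrderedRing K₁ :=
    Function.Injective.isStrictOrderedRing (algebraMap K₁ N) (map_zero _) (map_one _) (map_add _)
      (map_mul _) Iff.rfl Iff.rfl
  exact (PolynomialIVT.of_algebraicallyClosedIn (F := K₁) (N := N) (fun _ _ => Iff.rfl)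
    hN.polynomialIVT fun y hy => (hK₁ y).2 (hy.restrictScalars K)).isRealClosedField

end RelativeClosure

section DifferentialAlgebra

open Polynomial

/-- The Mathlib derivation underlying a `FieldDeriv`. -/
def FieldDeriv.toDerivation {F : Type} [Field F] (d : FieldDeriv F) : Derivation ℤ F F :=
  Derivation.mk' (AddMonoidHom.mk' d.d d.map_add).toIntLinearMap fun a b => by
    change d.d (a * b) = a * d.d b + b * d.d a
    rw [d.leibniz, mul_comm b]

theorem FieldDeriv.toDerivation_apply {F : Type} [Field F] (d : FieldDeriv F) (x : F) :
    d.toDerivation x = d.d x := rfl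

/-- Coefficientwise derivative of a polynomial. -/
noncomputable def FieldDeriv.mapCoeffs {F : Type} [Field F] (d : FieldDeriv F) (p : F[X]) : F[X] :=
  let _ : Differential F := ⟨d.toDerivation⟩
  Differential.mapCoeffs p

theorem FieldDeriv.coeff_mapCoeffs {F : Type} [Field F] (d : FieldDeriv F) (p : F[X]) (i : ℕ) :
    (d.mapCoeffs p).coeff i = d.d (p.coeff i) := rfl

theorem FieldDeriv.map_aeval {F E : Type} [Field F] [Field E] [Algebra F E] {dF : FieldDeriv F}
    {dE : FieldDeriv E} (hd : ∀ a, dE.d (algebraMap F E a) = algebraMap F E (dF.d a))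
    (p : F[X]) (x : E) :
    dE.d (aeval x p) = aeval x (dF.mapCoeffs p) + aeval x (derivative p) * dE.d x := by
  let _ : Differential F := ⟨dF.toDerivation⟩
  let _ : Differential E := ⟨dE.toDerivation⟩
  have : DifferentialAlgebra F E := ⟨hd⟩
  exact Differential.deriv_aeval_eq x p

theorem FieldDeriv.exists_extension_of_isAlgebraic {K E : Type} [Field K] [CharZero K] [Field E]
    [Algebra K E] [Algebra.IsAlgebraic K E] (dK : FieldDeriv K) :
    ∃ D : E → E, ∀ (N : Type) [Field N] [Algebra K N] (dN : FieldDeriv N),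
      (∀ a, dN.d (algebraMap K N a) = algebraMap K N (dK.d a)) →
      ∀ (g : E →ₐ[K] N) (a : E), dN.d (g a) = g (D a) := by
  refine ⟨fun a => -aeval a (dK.mapCoeffs (minpoly K a)) / aeval a (derivative (minpoly K a)), ?_⟩
  intro N _ _ dN hd g a
  have hsep : aeval a (derivative (minpoly K a)) ≠ 0 :=
    (minpoly.irreducible (Algebra.IsIntegral.isIntegral a)).separable.aeval_derivative_ne_zero
      (minpoly.aeval K a)
  have h := FieldDeriv.map_aeval hd (minpoly K a) (g a)
  rw [aeval_algHom_apply, minpoly.aeval, map_zero, ← dN.toDerivation_apply, map_zero,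
    aeval_algHom_apply, aeval_algHom_apply] at h
  have hg : g (aeval a (derivative (minpoly K a))) ≠ 0 := by simpa using hsep
  rw [map_div₀, map_neg, eq_div_iff hg]
  linear_combination -h

theorem FieldDeriv.isAlgebraic_of_eq_zero {k L N : Type} [Field k] [Field L] [Field N]
    [Algebra k L] [Algebra L N] [Algebra k N] [IsScalarTower k L N] {dL : FieldDeriv L}
    {dN : FieldDeriv N} (hd : ∀ a, dN.d (algebraMap L N a) = algebraMap L N (dL.d a))
    (hL : ∀ x : L, dL.d x = 0 → x ∈ Set.range (algebraMap k L)) {x : N} (hx : IsAlgebraic L x)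
    (hdx : dN.d x = 0) : IsAlgebraic k x := by
  have hm := minpoly.monic hx.isIntegral
  have h := FieldDeriv.map_aeval hd (minpoly L x) x
  rw [minpoly.aeval, ← dN.toDerivation_apply, map_zero, hdx, mul_zero, add_zero] at h
  have h0 : dL.mapCoeffs (minpoly L x) = 0 := by
    by_contra hne
    have hle : (dL.mapCoeffs (minpoly L x)).natDegree < (minpoly L x).natDegree := by
      refine lt_of_le_of_ne (natDegree_le_iff_coeff_eq_zero.2 fun i hi => ?_) fun he => ?_
      · rw [dL.coeff_mapCoeffs, coeff_eq_zero_of_natDegree_lt hi, ← dL.toDerivation_apply,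
          map_zero]
      · apply hne
        rw [← leadingCoeff_eq_zero, leadingCoeff, he, dL.coeff_mapCoeffs, hm.coeff_natDegree,
          ← dL.toDerivation_apply, Derivation.map_one_eq_zero]
    exact absurd (natDegree_le_natDegree (minpoly.degree_le_of_ne_zero L x hne h.symm))
      (not_le.2 hle)
  have hlift : minpoly L x ∈ Polynomial.lifts (algebraMap k L) := by
    rw [Polynomial.lifts_iff_coeff_lifts]
    intro i
    apply hL
    rw [← dL.coeff_mapCoeffs, h0, coeff_zero]
  obtain ⟨q, hq⟩ := (Polynomial.mem_lifts _).1 hlift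
  refine ⟨q, ?_, ?_⟩
  · rintro rfl
    exact hm.ne_zero (by rw [← hq, Polynomial.map_zero])
  · rw [← aeval_map_algebraMap L, hq, minpoly.aeval]

end DifferentialAlgebra

section RealClosurePicardVessiot

theorem FieldDeriv.mem_adjoin {F E : Type} [Field F] [Field E] [Algebra F E] (d : FieldDeriv E)
    {S : Set E} (hF : ∀ a : F, d.d (algebraMap F E a) ∈ IntermediateField.adjoin F S)
    (hS : ∀ s ∈ S, d.d s ∈ IntermediateField.adjoin F S) {x : E}
    (hx : x ∈ IntermediateField.adjoin F S) : d.d x ∈ IntermediateField.adjoin F S := by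
  induction hx using IntermediateField.adjoin_induction with
  | mem x hx => exact hS x hx
  | algebraMap a => exact hF a
  | add x y _ _ hx hy => rw [d.map_add]; exact add_mem hx hy
  | inv x hx hdx =>
    rw [← d.toDerivation_apply, Derivation.leibniz_inv, smul_eq_mul]
    exact mul_mem (neg_mem (pow_mem (inv_mem hx) 2)) hdx
  | mul x y hx hy hdx hdy =>
    rw [d.leibniz]
    exact add_mem (mul_mem hx hdy) (mul_mem hdx hy)

theorem IntermediateField.adjoin_image_eq_of_adjoin_eq_top {K L K₁ N : Type} [Field K] [Field L]
    [Field K₁] [Field N] [Algebra K L] [Algebra K K₁] [Algebra K N] [Algebra L N] [Algebra K₁ N]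
    [IsScalarTower K L N] [IsScalarTower K K₁ N] {S : Set L}
    (hS : IntermediateField.adjoin K S = ⊤) :
    IntermediateField.adjoin K₁ (algebraMap L N '' S) =
      IntermediateField.adjoin K₁ (Set.range (algebraMap L N)) := by
  refine le_antisymm (IntermediateField.adjoin.mono _ _ _ (Set.image_subset_range _ _)) ?_
  rw [IntermediateField.adjoin_le_iff]
  have h : IntermediateField.adjoin K S ≤
      ((IntermediateField.adjoin K₁ (algebraMap L N '' S)).restrictScalars K).comap
        (IsScalarTower.toAlgHom K L N) := by
    rw [IntermediateField.adjoin_le_iff]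
    exact fun x hx => IntermediateField.subset_adjoin K₁ _ ⟨x, hx, rfl⟩
  rintro _ ⟨x, rfl⟩
  have hx : x ∈ IntermediateField.adjoin K S := hS ▸ IntermediateField.mem_top
  exact h hx

theorem FieldDeriv.exists_const_of_eq_zero {k K L N : Type} [Field k] [Field K] [Field L] [Field N]
    [Algebra k K] [Algebra K L] [Algebra L N] [Algebra K N] [IsScalarTower K L N]
    {dK : FieldDeriv K} {dL : FieldDeriv L} {dN : FieldDeriv N}
    (hconst : ∀ a : K, dK.d a = 0 ↔ a ∈ Set.range (algebraMap k K)) (hk : IsRealClosedField k)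
    (hL : ∀ x : L, dL.d x = 0 → ∃ a : K, dK.d a = 0 ∧ algebraMap K L a = x)
    (hN : IsFormallyRealField N) (halg : Algebra.IsAlgebraic L N)
    (hd : ∀ a, dN.d (algebraMap L N a) = algebraMap L N (dL.d a)) {x : N} (hx : dN.d x = 0) :
    ∃ c : k, algebraMap K N (algebraMap k K c) = x := by
  let _ : Algebra k L := ((algebraMap K L).comp (algebraMap k K)).toAlgebra
  let _ : Algebra k N := ((algebraMap K N).comp (algebraMap k K)).toAlgebra
  have : IsScalarTower k L N := IsScalarTower.of_algebraMap_eq fun c => by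
    change algebraMap K N _ = algebraMap L N (algebraMap K L _)
    rw [IsScalarTower.algebraMap_apply K L N]
  refine hk.mem_range_of_isAlgebraic hN
    (FieldDeriv.isAlgebraic_of_eq_zero hd (fun y hy => ?_) (halg.isAlgebraic x) hx)
  obtain ⟨a, ha, rfl⟩ := hL y hy
  obtain ⟨c, rfl⟩ := (hconst a).1 ha
  exact ⟨c, rfl⟩

end RealClosurePicardVessiot

section FundamentalMatrix

open Matrix

theorem FieldDeriv.map_matrix_mul {N : Type} [Field N] (d : FieldDeriv N) {n : ℕ}
    (G H : Matrix (Fin n) (Fin n) N) :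
    (G * H).map d.d = G.map d.d * H + G * H.map d.d := by
  ext i j
  simp only [Matrix.map_apply, Matrix.mul_apply, Matrix.add_apply]
  rw [← d.toDerivation_apply, map_sum, ← Finset.sum_add_distrib]
  refine Finset.sum_congr rfl fun l _ => ?_
  rw [d.toDerivation_apply, d.leibniz, add_comm]

theorem FieldDeriv.eq_mul_const {N : Type} [Field N] (d : FieldDeriv N) {n : ℕ}
    {A F G : Matrix (Fin n) (Fin n) N} (hF : IsUnit F.det) (hdF : F.map d.d = A * F)
    (hdG : G.map d.d = A * G) : G = F * (F⁻¹ * G) ∧ (F⁻¹ * G).map d.d = 0 := by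
  have h : G = F * (F⁻¹ * G) := by rw [Matrix.mul_nonsing_inv_cancel_left _ _ hF]
  refine ⟨h, ?_⟩
  have h' := d.map_matrix_mul F (F⁻¹ * G)
  rw [← h, hdG, hdF, Matrix.mul_assoc, ← h, left_eq_add] at h'
  rw [← Matrix.nonsing_inv_mul_cancel_left _ ((F⁻¹ * G).map d.d) hF, h', Matrix.mul_zero]

theorem FieldDeriv.mem_range_of_fundamentalMatrix {K L₁ L₂ N : Type} [Field K] [Field L₁]
    [Field L₂] [Field N] [Algebra K L₁] [Algebra K L₂] [Algebra L₂ N] [Algebra K N]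
    [IsScalarTower K L₂ N] {d₁ : FieldDeriv L₁} {d₂ : FieldDeriv L₂} {dN : FieldDeriv N}
    {n : ℕ} {A : Matrix (Fin n) (Fin n) K} {F₁ : Matrix (Fin n) (Fin n) L₁}
    {F₂ : Matrix (Fin n) (Fin n) L₂} (hF₂ : IsUnit F₂.det)
    (hdF₁ : ∀ i j, d₁.d (F₁ i j) = (A.map (algebraMap K L₁) * F₁) i j)
    (hdF₂ : ∀ i j, d₂.d (F₂ i j) = (A.map (algebraMap K L₂) * F₂) i j)
    (hgen : IntermediateField.adjoin K (Set.range fun q : Fin n × Fin n => F₁ q.1 q.2) = ⊤)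
    (hd : ∀ a, dN.d (algebraMap L₂ N a) = algebraMap L₂ N (d₂.d a))
    (hconst : ∀ x : N, dN.d x = 0 → x ∈ Set.range (algebraMap K N))
    (Φ : L₁ →ₐ[K] N) (hΦ : ∀ x, dN.d (Φ x) = Φ (d₁.d x)) (x : L₁) :
    ∃ y : L₂, algebraMap L₂ N y = Φ x := by
  have hdet : IsUnit (F₂.map (algebraMap L₂ N)).det := by
    have := hF₂.map (algebraMap L₂ N)
    rwa [RingHom.map_det] at this
  have e₂ : (F₂.map (algebraMap L₂ N)).map dN.d =
      A.map (algebraMap K N) * F₂.map (algebraMap L₂ N) := by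
    ext i j
    simp only [Matrix.map_apply, Matrix.mul_apply, hd, hdF₂, map_sum, map_mul,
      ← IsScalarTower.algebraMap_apply]
  have e₁ : (F₁.map Φ).map dN.d = A.map (algebraMap K N) * F₁.map Φ := by
    ext i j
    simp only [Matrix.map_apply, Matrix.mul_apply, hΦ, hdF₁, map_sum, map_mul, AlgHom.commutes]
  obtain ⟨h, h0⟩ := dN.eq_mul_const hdet e₂ e₁
  have hle : IntermediateField.adjoin K (Set.range fun q : Fin n × Fin n => F₁ q.1 q.2) ≤
      (IsScalarTower.toAlgHom K L₂ N).fieldRange.comap Φ := by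
    rw [IntermediateField.adjoin_le_iff]
    rintro _ ⟨q, rfl⟩
    change Φ (F₁ q.1 q.2) ∈ (IsScalarTower.toAlgHom K L₂ N).fieldRange
    have hq := congrFun (congrFun h q.1) q.2
    rw [Matrix.map_apply, Matrix.mul_apply] at hq
    rw [hq]
    refine sum_mem fun l _ => mul_mem ⟨F₂ q.1 l, rfl⟩ ?_
    obtain ⟨a, ha⟩ := hconst _ (congrFun (congrFun h0 l) q.2)
    rw [← ha]
    exact algebraMap_mem _ a
  have hx : x ∈ IntermediateField.adjoin K (Set.range fun q : Fin n × Fin n => F₁ q.1 q.2) :=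
    hgen ▸ IntermediateField.mem_top
  exact hle hx

end FundamentalMatrix

section CoefficientwiseDerivative

open MvPolynomial

/-- `g` is the polynomial obtained from `f` by differentiating each coefficient. -/
def FieldDeriv.IsCoeffDeriv {N σ : Type} [Field N] (d : FieldDeriv N) (f g : MvPolynomial σ N) :
    Prop :=
  ∀ m, g.coeff m = d.d (f.coeff m)

namespace FieldDeriv.IsCoeffDeriv

variable {N σ : Type} [Field N] {d : FieldDeriv N} {f f' g g' : MvPolynomial σ N}

theorem add (h : d.IsCoeffDeriv f g) (h' : d.IsCoeffDeriv f' g') :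
    d.IsCoeffDeriv (f + f') (g + g') := fun m => by
  rw [coeff_add, coeff_add, h, h', d.map_add]

theorem zero : d.IsCoeffDeriv (0 : MvPolynomial σ N) 0 := fun m => by
  rw [coeff_zero, ← d.toDerivation_apply, map_zero]

theorem sum {ι : Type} (s : Finset ι) (u v : ι → MvPolynomial σ N)
    (h : ∀ i ∈ s, d.IsCoeffDeriv (u i) (v i)) :
    d.IsCoeffDeriv (∑ i ∈ s, u i) (∑ i ∈ s, v i) := fun m => by
  rw [coeff_sum, coeff_sum, ← d.toDerivation_apply, map_sum]
  exact Finset.sum_congr rfl fun i hi => h i hi m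

theorem mul (h : d.IsCoeffDeriv f g) (h' : d.IsCoeffDeriv f' g') :
    d.IsCoeffDeriv (f * f') (f * g' + g * f') := fun m => by
  classical
  rw [coeff_add, coeff_mul, coeff_mul, coeff_mul, ← d.toDerivation_apply, map_sum,
    ← Finset.sum_add_distrib]
  refine Finset.sum_congr rfl fun i _ => ?_
  rw [d.toDerivation_apply, d.leibniz, h, h']

theorem C (a : N) : d.IsCoeffDeriv (C a : MvPolynomial σ N) (MvPolynomial.C (d.d a)) := fun m => by
  classical
  rw [coeff_C, coeff_C]
  split_ifs with hm
  · rfl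
  · rw [← d.toDerivation_apply, map_zero]

theorem X (i : σ) : d.IsCoeffDeriv (X i : MvPolynomial σ N) 0 := fun m => by
  classical
  rw [coeff_X, coeff_zero, ← d.toDerivation_apply]
  split_ifs with hm
  · rw [Derivation.map_one_eq_zero]
  · rw [map_zero]

theorem C_mul_X (a : N) (i : σ) :
    d.IsCoeffDeriv (MvPolynomial.C a * MvPolynomial.X i) (MvPolynomial.C (d.d a) * MvPolynomial.X i)
      := by
  simpa using (C (d := d) a).mul (X i)

theorem smul (c : N) (h : d.IsCoeffDeriv f g) :
    d.IsCoeffDeriv (c • f) (c • g + d.d c • f) := by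
  simpa [smul_eq_C_mul] using (C (d := d) c).mul h

end FieldDeriv.IsCoeffDeriv

theorem FieldDeriv.exists_const_of_mem_stable_submodule {N σ : Type} [Field N]
    (d : FieldDeriv N) (J : Submodule N (MvPolynomial σ N))
    (hJ : ∀ f ∈ J, ∃ g ∈ J, d.IsCoeffDeriv f g) {f : MvPolynomial σ N} (hf : f ∈ J)
    (hf0 : f ≠ 0) :
    ∃ g ∈ J, g.support ⊆ f.support ∧ (∀ m, d.d (g.coeff m) = 0) ∧ ∃ m, g.coeff m = 1 := by
  classical
  induction hc : f.support.card using Nat.strong_induction_on generalizing f with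
  | _ c ih =>
    obtain ⟨m, hm⟩ := MvPolynomial.support_nonempty.2 hf0
    have hm' : f.coeff m ≠ 0 := MvPolynomial.mem_support_iff.1 hm
    have hsupp : ((f.coeff m)⁻¹ • f).support = f.support := by
      ext i
      simp [MvPolynomial.mem_support_iff, hm']
    have hmem : (f.coeff m)⁻¹ • f ∈ J := J.smul_mem _ hf
    obtain ⟨g, hg, hfg⟩ := hJ _ hmem
    have hone : ((f.coeff m)⁻¹ • f).coeff m = 1 := by
      rw [coeff_smul, smul_eq_mul, inv_mul_cancel₀ hm']
    by_cases hg0 : g = 0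
    · refine ⟨_, hmem, hsupp.le, fun i => ?_, m, hone⟩
      rw [← hfg i, hg0, coeff_zero]
    · have hss : g.support ⊂ f.support := by
        rw [Finset.ssubset_iff_of_subset]
        · refine ⟨m, hm, ?_⟩
          rw [MvPolynomial.notMem_support_iff, hfg, hone, ← d.toDerivation_apply,
            Derivation.map_one_eq_zero]
        · intro i hi
          rw [← hsupp]
          rw [MvPolynomial.mem_support_iff] at hi ⊢
          intro h0
          rw [hfg, h0, ← d.toDerivation_apply, map_zero] at hi
          exact hi rfl
      obtain ⟨g', hg', hs, hrest⟩ := ih _ (hc ▸ Finset.card_lt_card hss) hg hg0 rfl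
      exact ⟨g', hg', hs.trans hss.1, hrest⟩

theorem FieldDeriv.stable_submodule_le_span_const {N σ : Type} [Field N]
    (d : FieldDeriv N) (J : Submodule N (MvPolynomial σ N))
    (hJ : ∀ f ∈ J, ∃ g ∈ J, d.IsCoeffDeriv f g) :
    J ≤ Submodule.span N {g | g ∈ J ∧ ∀ m, d.d (g.coeff m) = 0} := by
  classical
  intro f hf
  induction hc : f.support.card using Nat.strong_induction_on generalizing f with
  | _ c ih =>
    by_cases hf0 : f = 0
    · rw [hf0]
      exact zero_mem _
    obtain ⟨g, hg, hs, hg', m, hm⟩ := d.exists_const_of_mem_stable_submodule J hJ hf hf0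
    have hss : (f - f.coeff m • g).support ⊂ f.support := by
      rw [Finset.ssubset_iff_of_subset]
      · refine ⟨m, hs (by rw [MvPolynomial.mem_support_iff, hm]; exact one_ne_zero), ?_⟩
        rw [MvPolynomial.notMem_support_iff, coeff_sub, coeff_smul, hm, smul_eq_mul, mul_one,
          sub_self]
      · intro i hi
        by_contra h
        rw [MvPolynomial.mem_support_iff, coeff_sub, coeff_smul,
          MvPolynomial.notMem_support_iff.1 h,
          MvPolynomial.notMem_support_iff.1 fun h' => h (hs h'), smul_zero, sub_zero] at hi
        exact hi rfl
    have h1 := ih _ (hc ▸ Finset.card_lt_card hss) (J.sub_mem hf (J.smul_mem _ hg)) rfl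
    have h2 : f.coeff m • g ∈ Submodule.span N {g | g ∈ J ∧ ∀ m, d.d (g.coeff m) = 0} :=
      Submodule.smul_mem _ _ (Submodule.subset_span ⟨hg, hg'⟩)
    simpa using add_mem h1 h2

end CoefficientwiseDerivative

section ConstantSpecialization

open MvPolynomial

theorem FieldDeriv.exists_polynomial_deriv {K N₁ N₂ : Type} [Field K] [Field N₁] [Field N₂]
    [Algebra K N₁] [Algebra K N₂] {D : FieldDeriv K} {d₁ : FieldDeriv N₁} {d₂ : FieldDeriv N₂}
    (h₁ : ∀ a, d₁.d (algebraMap K N₁ a) = algebraMap K N₁ (D.d a))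
    (h₂ : ∀ a, d₂.d (algebraMap K N₂ a) = algebraMap K N₂ (D.d a))
    {n : ℕ} {A : Matrix (Fin n) (Fin n) K} {F₁ : Matrix (Fin n) (Fin n) N₁}
    {F₂ : Matrix (Fin n) (Fin n) N₂}
    (hF₁ : F₁.map d₁.d = A.map (algebraMap K N₁) * F₁)
    (hF₂ : F₂.map d₂.d = A.map (algebraMap K N₂) * F₂)
    (P : MvPolynomial (Fin n × Fin n) K) :
    ∃ P' : MvPolynomial (Fin n × Fin n) K,
      d₁.d (aeval (fun q => F₁ q.1 q.2) P) = aeval (fun q => F₁ q.1 q.2) P' ∧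
      d₂.IsCoeffDeriv
        (aeval (fun q => ∑ l, C (F₂ q.1 l) * X (l, q.2) :
          Fin n × Fin n → MvPolynomial (Fin n × Fin n) N₂) P)
        (aeval (fun q => ∑ l, C (F₂ q.1 l) * X (l, q.2)) P') := by
  induction P using MvPolynomial.induction_on with
  | C a =>
    refine ⟨C (D.d a), ?_, ?_⟩
    · simp only [aeval_C, h₁]
    · simp only [aeval_C, MvPolynomial.algebraMap_apply, ← h₂]
      exact FieldDeriv.IsCoeffDeriv.C _
  | add p q hp hq =>
    obtain ⟨p', hp1, hp2⟩ := hp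
    obtain ⟨q', hq1, hq2⟩ := hq
    refine ⟨p' + q', ?_, ?_⟩
    · rw [_root_.map_add, _root_.map_add, d₁.map_add, hp1, hq1]
    · rw [_root_.map_add, _root_.map_add]
      exact hp2.add hq2
  | mul_X p q hp =>
    obtain ⟨p', hp1, hp2⟩ := hp
    refine ⟨p * (∑ s, C (A q.1 s) * X (s, q.2)) + p' * X q, ?_, ?_⟩
    · have h := congrFun (congrFun hF₁ q.1) q.2
      rw [Matrix.map_apply, Matrix.mul_apply] at h
      simp only [_root_.map_add, map_mul, aeval_X, d₁.leibniz, hp1, h, map_sum, aeval_C,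
        Matrix.map_apply]
    · have hX : d₂.IsCoeffDeriv (∑ l, C (F₂ q.1 l) * X (l, q.2))
          (aeval (fun q => ∑ l, C (F₂ q.1 l) * X (l, q.2) :
            Fin n × Fin n → MvPolynomial (Fin n × Fin n) N₂)
            (∑ s, C (A q.1 s) * X (s, q.2))) := by
        have h := FieldDeriv.IsCoeffDeriv.sum (d := d₂) Finset.univ
          (fun l => C (F₂ q.1 l) * X (l, q.2) : Fin n → MvPolynomial (Fin n × Fin n) N₂) _
          fun l _ => FieldDeriv.IsCoeffDeriv.C_mul_X (F₂ q.1 l) (l, q.2)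
        convert h using 1
        simp only [map_sum, map_mul, aeval_C, aeval_X, MvPolynomial.algebraMap_apply,
          Finset.mul_sum]
        rw [Finset.sum_comm]
        refine Finset.sum_congr rfl fun l _ => ?_
        have h' := congrFun (congrFun hF₂ q.1) l
        rw [Matrix.map_apply, Matrix.mul_apply] at h'
        rw [h', map_sum, Finset.sum_mul]
        refine Finset.sum_congr rfl fun s _ => ?_
        rw [map_mul, mul_assoc, Matrix.map_apply]
      simp only [_root_.map_add, map_mul, aeval_X]
      exact hp2.mul hX

theorem FieldDeriv.exists_const_specialization {k K N₁ N₂ : Type} [Field k] [Field K]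
    [Field N₁] [Field N₂] [Algebra K N₁] [Algebra K N₂] [Algebra k N₂]
    (hk : IsRealClosedField k) (hK : IsRealClosedField K) (hN₁ : IsRealClosedField N₁)
    (hN₂ : IsRealClosedField N₂)
    {D : FieldDeriv K} {d₁ : FieldDeriv N₁} {d₂ : FieldDeriv N₂}
    (h₁ : ∀ a, d₁.d (algebraMap K N₁ a) = algebraMap K N₁ (D.d a))
    (h₂ : ∀ a, d₂.d (algebraMap K N₂ a) = algebraMap K N₂ (D.d a))
    (hconst : ∀ x : N₂, d₂.d x = 0 → x ∈ Set.range (algebraMap k N₂))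
    {n : ℕ} {A : Matrix (Fin n) (Fin n) K} {F₁ : Matrix (Fin n) (Fin n) N₁}
    {F₂ : Matrix (Fin n) (Fin n) N₂} (hdet₁ : IsUnit F₁.det) (hdet₂ : IsUnit F₂.det)
    (hF₁ : F₁.map d₁.d = A.map (algebraMap K N₁) * F₁)
    (hF₂ : F₂.map d₂.d = A.map (algebraMap K N₂) * F₂) :
    ∃ C₀ : Matrix (Fin n) (Fin n) k, IsUnit C₀.det ∧
      ∀ P : MvPolynomial (Fin n × Fin n) K, aeval (fun q => F₁ q.1 q.2) P = 0 →
        aeval (fun q => (F₂ * C₀.map (algebraMap k N₂)) q.1 q.2) P = 0 := by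
  obtain ⟨F', hF', hspec⟩ := hK.exists_matrix_specialization hN₁ F₁ hdet₁
  have hdetF' : IsUnit (F'.map (algebraMap K N₂)).det := by
    have := hF'.map (algebraMap K N₂)
    rwa [RingHom.map_det] at this
  have hdet₂' : IsUnit (F₂⁻¹).det := by rwa [Matrix.isUnit_nonsing_inv_det_iff]
  obtain ⟨C₀, hC₀, hspec₀⟩ := hk.exists_matrix_specialization hN₂
    (F₂⁻¹ * F'.map (algebraMap K N₂)) (by rw [Matrix.det_mul]; exact hdet₂'.mul hdetF')
  refine ⟨C₀, hC₀, ?_⟩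
  let T : MvPolynomial (Fin n × Fin n) K →ₐ[K] MvPolynomial (Fin n × Fin n) N₂ :=
    aeval fun q => ∑ l, C (F₂ q.1 l) * X (l, q.2)
  have hT : ∀ (G : Matrix (Fin n) (Fin n) N₂) (P : MvPolynomial (Fin n × Fin n) K),
      eval (fun q => G q.1 q.2) (T P) = aeval (fun q => (F₂ * G) q.1 q.2) P := by
    intro G P
    induction P using MvPolynomial.induction_on with
    | C a => simp [T, MvPolynomial.algebraMap_apply]
    | add p q hp hq => rw [_root_.map_add, _root_.map_add, _root_.map_add, hp, hq]
    | mul_X p q hp =>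
      rw [map_mul, map_mul, map_mul, hp, aeval_X, aeval_X, Matrix.mul_apply, map_sum]
      simp
  let J : Submodule N₂ (MvPolynomial (Fin n × Fin n) N₂) :=
    Submodule.span N₂ (T '' {P | aeval (fun q => F₁ q.1 q.2) P = 0})
  have hJ : ∀ f ∈ J, ∃ g ∈ J, d₂.IsCoeffDeriv f g := by
    intro f hf
    induction hf using Submodule.span_induction with
    | mem f hf =>
      obtain ⟨P, hP, rfl⟩ := hf
      obtain ⟨P', hP1, hP2⟩ := FieldDeriv.exists_polynomial_deriv h₁ h₂ hF₁ hF₂ P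
      refine ⟨T P', Submodule.subset_span ⟨P', ?_, rfl⟩, hP2⟩
      have hP0 : aeval (fun q => F₁ q.1 q.2) P = 0 := hP
      change aeval (fun q => F₁ q.1 q.2) P' = 0
      rw [← hP1, hP0, ← d₁.toDerivation_apply, map_zero]
    | zero => exact ⟨0, zero_mem _, FieldDeriv.IsCoeffDeriv.zero⟩
    | add f f' _ _ hf hf' =>
      obtain ⟨g, hg, h⟩ := hf
      obtain ⟨g', hg', h'⟩ := hf'
      exact ⟨g + g', add_mem hg hg', h.add h'⟩
    | smul c f hf0 hf =>
      obtain ⟨g, hg, h⟩ := hf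
      exact ⟨_, add_mem (J.smul_mem c hg) (J.smul_mem (d₂.d c) hf0), h.smul c⟩
  have hJC : ∀ f ∈ J,
      eval (fun q => (F₂⁻¹ * F'.map (algebraMap K N₂)) q.1 q.2) f = 0 := by
    intro f hf
    induction hf using Submodule.span_induction with
    | mem f hf =>
      obtain ⟨P, hP, rfl⟩ := hf
      rw [hT, Matrix.mul_nonsing_inv_cancel_left _ _ hdet₂]
      have : aeval (fun q : Fin n × Fin n => algebraMap K N₂ (F' q.1 q.2)) P = _ :=
        aeval_algebraMap_apply N₂ (fun q : Fin n × Fin n => F' q.1 q.2) P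
      simp only [Matrix.map_apply]
      rw [this]
      exact (congrArg _ (hspec P hP)).trans (map_zero _)
    | zero => rw [map_zero]
    | add f f' _ _ hf hf' => rw [_root_.map_add, hf, hf', add_zero]
    | smul c f _ hf => rw [smul_eval, hf, mul_zero]
  have hJ₀ : ∀ f ∈ J, eval (fun q => (C₀.map (algebraMap k N₂)) q.1 q.2) f = 0 := by
    intro f hf
    have hspan := d₂.stable_submodule_le_span_const J hJ hf
    clear hf
    induction hspan using Submodule.span_induction with
    | mem f hf =>
      obtain ⟨f₀, rfl⟩ : ∃ f₀ : MvPolynomial (Fin n × Fin n) k,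
          MvPolynomial.map (algebraMap k N₂) f₀ = f := by
        refine MvPolynomial.mem_range_map_iff_coeffs_subset.2 fun a ha => ?_
        obtain ⟨m, -, rfl⟩ := MvPolynomial.mem_coeffs_iff.1 ha
        exact hconst _ (hf.2 m)
      have h0 := hJC _ hf.1
      rw [eval_map, ← aeval_def] at h0
      have : aeval (fun q : Fin n × Fin n => algebraMap k N₂ (C₀ q.1 q.2)) f₀ = _ :=
        aeval_algebraMap_apply N₂ (fun q : Fin n × Fin n => C₀ q.1 q.2) f₀
      simp only [Matrix.map_apply]
      rw [eval_map, ← aeval_def, this]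
      exact (congrArg _ (hspec₀ f₀ h0)).trans (map_zero _)
    | zero => rw [map_zero]
    | add f f' _ _ hf hf' => rw [_root_.map_add, hf, hf', add_zero]
    | smul c f _ hf => rw [smul_eval, hf, mul_zero]
  intro P hP
  rw [← hT]
  exact hJ₀ _ (Submodule.subset_span ⟨P, hP, rfl⟩)

end ConstantSpecialization

section Isomorphism

open MvPolynomial

theorem Ideal.comap_le_of_le_comap_of_surjective {R : Type} [CommRing R] [IsNoetherianRing R]
    (σ : R →+* R) (hσ : Function.Surjective σ) {I : Ideal R} (h : I ≤ I.comap σ) :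
    I.comap σ ≤ I := by
  have hstep : ∀ m : ℕ, I.comap (σ ^ m) ≤ I.comap (σ ^ (m + 1)) := by
    intro m x hx
    rw [Ideal.mem_comap] at hx ⊢
    rw [pow_succ']
    exact h hx
  obtain ⟨m, hm⟩ := monotone_stabilizes_iff_noetherian.2 (inferInstance : IsNoetherian R R)
    ⟨fun m => I.comap (σ ^ m), monotone_nat_of_le_succ hstep⟩
  intro x hx
  obtain ⟨y, rfl⟩ : ∃ y, (σ ^ m) y = x := by
    rw [RingHom.coe_pow]
    exact hσ.iterate m x
  have hy : y ∈ I.comap (σ ^ (m + 1)) := by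
    rw [Ideal.mem_comap, pow_succ']
    exact hx
  have he : I.comap (σ ^ m) = I.comap (σ ^ (m + 1)) := hm (m + 1) (Nat.le_succ m)
  rw [← he] at hy
  exact hy

theorem AlgHom.exists_algEquiv_of_ker_iff {R A B C : Type} [CommRing R] [CommRing A] [CommRing B]
    [CommRing C] [Algebra R A] [Algebra R B] [Algebra R C] (f : A →ₐ[R] B) (g : A →ₐ[R] C)
    (hf : Function.Surjective f) (hg : Function.Surjective g) (h : ∀ a, f a = 0 ↔ g a = 0) :
    ∃ e : B ≃ₐ[R] C, ∀ a, e (f a) = g a := by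
  have h1 : RingHom.ker f.toRingHom ≤ RingHom.ker g.toRingHom := fun a ha => (h a).1 ha
  have h2 : RingHom.ker g.toRingHom ≤ RingHom.ker f.toRingHom := fun a ha => (h a).2 ha
  refine ⟨AlgEquiv.ofAlgHom (f.liftOfSurjective hf g h1) (g.liftOfSurjective hg f h2)
    (AlgHom.ext fun c => ?_) (AlgHom.ext fun b => ?_), fun a => f.liftOfSurjective_apply hf g h1 a⟩
  · obtain ⟨a, rfl⟩ := hg c
    rw [AlgHom.comp_apply, AlgHom.liftOfSurjective_apply, AlgHom.liftOfSurjective_apply,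
      AlgHom.id_apply]
  · obtain ⟨a, rfl⟩ := hf b
    rw [AlgHom.comp_apply, AlgHom.liftOfSurjective_apply, AlgHom.liftOfSurjective_apply,
      AlgHom.id_apply]

/-- Evaluation at a family, as a map onto the subalgebra the family generates. -/
noncomputable def MvPolynomial.aevalAdjoin (K : Type) {N ι : Type} [Field K] [Field N]
    [Algebra K N] (u : ι → N) : MvPolynomial ι K →ₐ[K] Algebra.adjoin K (Set.range u) :=
  aeval fun i => ⟨u i, Algebra.subset_adjoin ⟨i, rfl⟩⟩

theorem MvPolynomial.coe_aevalAdjoin (K : Type) {N ι : Type} [Field K] [Field N] [Algebra K N]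
    (u : ι → N) (P : MvPolynomial ι K) : (aevalAdjoin K u P : N) = aeval u P := by
  have h : (Algebra.adjoin K (Set.range u)).val.comp (aevalAdjoin K u) = aeval u :=
    MvPolynomial.algHom_ext fun i => by simp [aevalAdjoin]
  exact AlgHom.congr_fun h P

theorem MvPolynomial.aevalAdjoin_surjective (K : Type) {N ι : Type} [Field K] [Field N]
    [Algebra K N] (u : ι → N) : Function.Surjective (aevalAdjoin K u) := by
  rintro ⟨x, hx⟩
  have hx' := hx
  rw [Algebra.adjoin_range_eq_range_aeval] at hx'
  obtain ⟨P, hP⟩ := hx'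
  exact ⟨P, Subtype.ext ((coe_aevalAdjoin K u P).trans hP)⟩

open IntermediateField IntermediateField.algebraAdjoinAdjoin in
theorem IntermediateField.exists_algEquiv_adjoin_of_ker_eq {K N₁ N₂ ι : Type} [Field K]
    [Field N₁] [Field N₂] [Algebra K N₁] [Algebra K N₂] (u : ι → N₁) (v : ι → N₂)
    (h : ∀ P : MvPolynomial ι K, aeval u P = 0 ↔ aeval v P = 0) :
    ∃ φ : IntermediateField.adjoin K (Set.range u) ≃ₐ[K] IntermediateField.adjoin K (Set.range v),
      ∀ i, (φ ⟨u i, IntermediateField.subset_adjoin _ _ ⟨i, rfl⟩⟩ : N₂) = v i := by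
  obtain ⟨e, he⟩ := AlgHom.exists_algEquiv_of_ker_iff (aevalAdjoin K u) (aevalAdjoin K v)
    (aevalAdjoin_surjective K u) (aevalAdjoin_surjective K v) fun P => by
      rw [← Subalgebra.coe_eq_zero, ← Subalgebra.coe_eq_zero, coe_aevalAdjoin, coe_aevalAdjoin, h]
  have hφ : ∀ x : Algebra.adjoin K (Set.range u),
      IsFractionRing.ringEquivOfRingEquiv (K := IntermediateField.adjoin K (Set.range u))
        (L := IntermediateField.adjoin K (Set.range v)) e.toRingEquiv (algebraMap _ _ x) =
      algebraMap _ _ (e x) := fun x => IsFractionRing.ringEquivOfRingEquiv_algebraMap _ _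
  refine ⟨AlgEquiv.ofRingEquiv (f := IsFractionRing.ringEquivOfRingEquiv
    (K := IntermediateField.adjoin K (Set.range u))
    (L := IntermediateField.adjoin K (Set.range v)) e.toRingEquiv) fun a => ?_, fun i => ?_⟩
  · exact (hφ (algebraMap K _ a)).trans (by rw [e.commutes]; rfl)
  · have h1 := hφ (aevalAdjoin K u (X i))
    rw [he] at h1
    have h2 : (algebraMap (Algebra.adjoin K (Set.range u))
        (IntermediateField.adjoin K (Set.range u)) (aevalAdjoin K u (X i))) =
        ⟨u i, IntermediateField.subset_adjoin _ _ ⟨i, rfl⟩⟩ := by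
      refine Subtype.ext ?_
      rw [coe_algebraMap, coe_aevalAdjoin, aeval_X]
    rw [h2] at h1
    refine (congrArg Subtype.val h1).trans ?_
    rw [coe_algebraMap, coe_aevalAdjoin, aeval_X]

end Isomorphism

section FundamentalIsomorphism

open MvPolynomial

/-- The substitution `X ↦ X * B` on polynomials in the entries of a square matrix. -/
noncomputable def MvPolynomial.rightMul {K : Type} [Field K] {n : ℕ}
    (B : Matrix (Fin n) (Fin n) K) :
    MvPolynomial (Fin n × Fin n) K →ₐ[K] MvPolynomial (Fin n × Fin n) K :=
  aeval fun q => (Matrix.mvPolynomialX (Fin n) (Fin n) K *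
    B.map (algebraMap K (MvPolynomial (Fin n × Fin n) K))) q.1 q.2

theorem MvPolynomial.aeval_rightMul {K R : Type} [Field K] [CommRing R] [Algebra K R] {n : ℕ}
    (B : Matrix (Fin n) (Fin n) K) (M : Matrix (Fin n) (Fin n) R)
    (P : MvPolynomial (Fin n × Fin n) K) :
    aeval (fun q => M q.1 q.2) (rightMul B P) =
      aeval (fun q => (M * B.map (algebraMap K R)) q.1 q.2) P := by
  have h : (aeval fun q : Fin n × Fin n => M q.1 q.2).comp (rightMul B) =
      aeval fun q => (M * B.map (algebraMap K R)) q.1 q.2 := by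
    refine MvPolynomial.algHom_ext fun q => ?_
    rw [AlgHom.comp_apply, rightMul, aeval_X, aeval_X, Matrix.mul_apply, Matrix.mul_apply, map_sum]
    simp
  exact AlgHom.congr_fun h P

theorem MvPolynomial.rightMul_surjective {K : Type} [Field K] {n : ℕ}
    {B : Matrix (Fin n) (Fin n) K} (hB : IsUnit B.det) : Function.Surjective (rightMul B) := by
  intro P
  refine ⟨rightMul B⁻¹ P, ?_⟩
  have h := aeval_rightMul B⁻¹
    (Matrix.mvPolynomialX (Fin n) (Fin n) K * B.map (algebraMap K (MvPolynomial _ K))) P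
  rw [Matrix.mul_assoc, ← Matrix.map_mul, Matrix.mul_nonsing_inv _ hB,
    Matrix.map_one _ (map_zero _) (map_one _), Matrix.mul_one] at h
  refine h.trans ?_
  exact aeval_X_left_apply P

theorem IntermediateField.adjoin_mul_matrix {K N : Type} [Field K] [Field N] [Algebra K N] {n : ℕ}
    (F : Matrix (Fin n) (Fin n) N) {B : Matrix (Fin n) (Fin n) K} (hB : IsUnit B.det) :
    IntermediateField.adjoin K
      (Set.range fun q : Fin n × Fin n => (F * B.map (algebraMap K N)) q.1 q.2) =
    IntermediateField.adjoin K (Set.range fun q : Fin n × Fin n => F q.1 q.2) := by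
  have key : ∀ (G : Matrix (Fin n) (Fin n) N) (B : Matrix (Fin n) (Fin n) K),
      IntermediateField.adjoin K
        (Set.range fun q : Fin n × Fin n => (G * B.map (algebraMap K N)) q.1 q.2) ≤
      IntermediateField.adjoin K (Set.range fun q : Fin n × Fin n => G q.1 q.2) := by
    intro G B
    rw [IntermediateField.adjoin_le_iff]
    rintro _ ⟨q, rfl⟩
    change (G * B.map (algebraMap K N)) q.1 q.2 ∈ IntermediateField.adjoin K _
    rw [Matrix.mul_apply]
    exact sum_mem fun l _ => mul_mem (IntermediateField.subset_adjoin _ _ ⟨(q.1, l), rfl⟩)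
      (algebraMap_mem _ _)
  refine le_antisymm (key F B) ?_
  have h := key (F * B.map (algebraMap K N)) B⁻¹
  rwa [Matrix.mul_assoc, ← Matrix.map_mul, Matrix.mul_nonsing_inv _ hB,
    Matrix.map_one _ (map_zero _) (map_one _), Matrix.mul_one] at h

theorem FieldDeriv.exists_comm_of_adjoin {K N₁ N₂ : Type} [Field K] [Field N₁] [Field N₂]
    [Algebra K N₁] [Algebra K N₂] {D : FieldDeriv K} {d₁ : FieldDeriv N₁} {d₂ : FieldDeriv N₂}
    (h₁ : ∀ a, d₁.d (algebraMap K N₁ a) = algebraMap K N₁ (D.d a))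
    (h₂ : ∀ a, d₂.d (algebraMap K N₂ a) = algebraMap K N₂ (D.d a)) {S : Set N₁}
    (φ : IntermediateField.adjoin K S →ₐ[K] N₂)
    (hS : ∀ s : IntermediateField.adjoin K S, (s : N₁) ∈ S →
      ∃ y : IntermediateField.adjoin K S, d₁.d (s : N₁) = (y : N₁) ∧ d₂.d (φ s) = φ y)
    (x : IntermediateField.adjoin K S) :
    ∃ y : IntermediateField.adjoin K S, d₁.d (x : N₁) = (y : N₁) ∧ d₂.d (φ x) = φ y := by
  obtain ⟨x, hx⟩ := x
  induction hx using IntermediateField.adjoin_induction with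
  | mem x hx => exact hS ⟨x, IntermediateField.subset_adjoin _ _ hx⟩ hx
  | algebraMap a =>
    refine ⟨algebraMap K _ (D.d a), h₁ a, ?_⟩
    rw [φ.commutes, ← h₂]
    exact congrArg d₂.d (φ.commutes a)
  | add x y hx hy hdx hdy =>
    obtain ⟨x', hx₁, hx₂⟩ := hdx
    obtain ⟨y', hy₁, hy₂⟩ := hdy
    refine ⟨x' + y', (d₁.map_add _ _).trans (congrArg₂ _ hx₁ hy₁), ?_⟩
    have h : φ ⟨x + y, add_mem hx hy⟩ = φ ⟨x, hx⟩ + φ ⟨y, hy⟩ :=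
      _root_.map_add φ ⟨x, hx⟩ ⟨y, hy⟩
    rw [h, _root_.map_add, d₂.map_add, hx₂, hy₂]
  | inv x hx hdx =>
    obtain ⟨x', hx₁, hx₂⟩ := hdx
    refine ⟨-⟨x, hx⟩⁻¹ ^ 2 * x', ?_, ?_⟩
    · rw [← d₁.toDerivation_apply, Derivation.leibniz_inv, smul_eq_mul, d₁.toDerivation_apply,
        hx₁]
      push_cast
      rfl
    · have h : φ ⟨x⁻¹, inv_mem hx⟩ = (φ ⟨x, hx⟩)⁻¹ := map_inv₀ φ ⟨x, hx⟩
      rw [h, ← d₂.toDerivation_apply, Derivation.leibniz_inv, smul_eq_mul, d₂.toDerivation_apply,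
        hx₂, map_mul, map_neg, map_pow, map_inv₀]
  | mul x y hx hy hdx hdy =>
    obtain ⟨x', hx₁, hx₂⟩ := hdx
    obtain ⟨y', hy₁, hy₂⟩ := hdy
    refine ⟨⟨x, hx⟩ * y' + x' * ⟨y, hy⟩, ?_, ?_⟩
    · rw [d₁.leibniz, hx₁, hy₁]
      rfl
    · have h : φ ⟨x * y, mul_mem hx hy⟩ = φ ⟨x, hx⟩ * φ ⟨y, hy⟩ := map_mul φ ⟨x, hx⟩ ⟨y, hy⟩
      rw [h, d₂.leibniz, hx₂, hy₂, _root_.map_add, map_mul, map_mul]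

theorem FieldDeriv.exists_algEquiv_adjoin {k K N₁ N₂ : Type} [Field k] [Field K]
    [Field N₁] [Field N₂] [Algebra k K] [Algebra K N₁] [Algebra K N₂] [Algebra k N₁] [Algebra k N₂]
    [IsScalarTower k K N₁] [IsScalarTower k K N₂]
    (hk : IsRealClosedField k) (hK : IsRealClosedField K) (hN₁ : IsRealClosedField N₁)
    (hN₂ : IsRealClosedField N₂)
    {D : FieldDeriv K} {d₁ : FieldDeriv N₁} {d₂ : FieldDeriv N₂}
    (h₁ : ∀ a, d₁.d (algebraMap K N₁ a) = algebraMap K N₁ (D.d a))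
    (h₂ : ∀ a, d₂.d (algebraMap K N₂ a) = algebraMap K N₂ (D.d a))
    (hD : ∀ c : k, D.d (algebraMap k K c) = 0)
    (hconst₁ : ∀ x : N₁, d₁.d x = 0 → x ∈ Set.range (algebraMap k N₁))
    (hconst₂ : ∀ x : N₂, d₂.d x = 0 → x ∈ Set.range (algebraMap k N₂))
    {n : ℕ} {A : Matrix (Fin n) (Fin n) K} {F₁ : Matrix (Fin n) (Fin n) N₁}
    {F₂ : Matrix (Fin n) (Fin n) N₂} (hdet₁ : IsUnit F₁.det) (hdet₂ : IsUnit F₂.det)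
    (hF₁ : F₁.map d₁.d = A.map (algebraMap K N₁) * F₁)
    (hF₂ : F₂.map d₂.d = A.map (algebraMap K N₂) * F₂) :
    ∃ φ : IntermediateField.adjoin K (Set.range fun q : Fin n × Fin n => F₁ q.1 q.2) ≃ₐ[K]
        IntermediateField.adjoin K (Set.range fun q : Fin n × Fin n => F₂ q.1 q.2),
      ∀ x y : IntermediateField.adjoin K (Set.range fun q : Fin n × Fin n => F₁ q.1 q.2),
        d₁.d (x : N₁) = (y : N₁) → d₂.d (φ x : N₂) = (φ y : N₂) := by
  obtain ⟨C₀, hC₀, hs₀⟩ := FieldDeriv.exists_const_specialization hk hK hN₁ hN₂ h₁ h₂ hconst₂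
    hdet₁ hdet₂ hF₁ hF₂
  obtain ⟨C₁, hC₁, hs₁⟩ := FieldDeriv.exists_const_specialization hk hK hN₂ hN₁ h₂ h₁ hconst₁
    hdet₂ hdet₁ hF₂ hF₁
  let B₀ : Matrix (Fin n) (Fin n) K := C₀.map (algebraMap k K)
  let B₁ : Matrix (Fin n) (Fin n) K := C₁.map (algebraMap k K)
  have hB₀ : IsUnit B₀.det := by
    have := hC₀.map (algebraMap k K)
    rwa [RingHom.map_det] at this
  have hB₁ : IsUnit B₁.det := by
    have := hC₁.map (algebraMap k K)
    rwa [RingHom.map_det] at this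
  have e₀ : C₀.map (algebraMap k N₂) = B₀.map (algebraMap K N₂) := by
    ext i j
    exact IsScalarTower.algebraMap_apply k K N₂ _
  have e₁ : C₁.map (algebraMap k N₁) = B₁.map (algebraMap K N₁) := by
    ext i j
    exact IsScalarTower.algebraMap_apply k K N₁ _
  rw [e₀] at hs₀
  rw [e₁] at hs₁
  let I : Ideal (MvPolynomial (Fin n × Fin n) K) :=
    RingHom.ker (aeval fun q : Fin n × Fin n => F₁ q.1 q.2 :
      MvPolynomial (Fin n × Fin n) K →ₐ[K] N₁)
  have hB : ∀ P, aeval (fun q => (F₂ * B₀.map (algebraMap K N₂)) q.1 q.2) P = 0 →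
      aeval (fun q => F₁ q.1 q.2) (rightMul (B₁ * B₀) P) = 0 := by
    intro P hP
    rw [← aeval_rightMul] at hP
    have h := hs₁ _ hP
    rw [aeval_rightMul] at h
    rw [aeval_rightMul, Matrix.map_mul, ← Matrix.mul_assoc]
    exact h
  have hI : I ≤ I.comap (rightMul (B₁ * B₀)).toRingHom := fun P hP => hB P (hs₀ P hP)
  have hI' := Ideal.comap_le_of_le_comap_of_surjective (rightMul (B₁ * B₀)).toRingHom
    (rightMul_surjective (by rw [Matrix.det_mul]; exact hB₁.mul hB₀)) hI
  have hker : ∀ P : MvPolynomial (Fin n × Fin n) K, aeval (fun q => F₁ q.1 q.2) P = 0 ↔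
      aeval (fun q => (F₂ * B₀.map (algebraMap K N₂)) q.1 q.2) P = 0 :=
    fun P => ⟨hs₀ P, fun hP => hI' (hB P hP)⟩
  obtain ⟨φ, hφ⟩ := IntermediateField.exists_algEquiv_adjoin_of_ker_eq
    (fun q : Fin n × Fin n => F₁ q.1 q.2)
    (fun q : Fin n × Fin n => (F₂ * B₀.map (algebraMap K N₂)) q.1 q.2) hker
  have hG : (F₂ * B₀.map (algebraMap K N₂)).map d₂.d =
      A.map (algebraMap K N₂) * (F₂ * B₀.map (algebraMap K N₂)) := by
    have h0 : (B₀.map (algebraMap K N₂)).map d₂.d = 0 := by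
      ext i j
      simp only [B₀, Matrix.map_apply, h₂, hD, map_zero, Matrix.zero_apply]
    rw [d₂.map_matrix_mul, h0, Matrix.mul_zero, add_zero, hF₂, Matrix.mul_assoc]
  refine ⟨φ.trans (IntermediateField.equivOfEq (IntermediateField.adjoin_mul_matrix F₂ hB₀)),
    fun x y hxy => ?_⟩
  have h := FieldDeriv.exists_comm_of_adjoin h₁ h₂
    ((IntermediateField.val _).comp φ.toAlgHom) (fun s hs => ?_) x
  · obtain ⟨z, hz₁, hz₂⟩ := h
    obtain rfl : y = z := Subtype.ext (hxy.symm.trans hz₁)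
    exact hz₂
  · obtain ⟨s, hs'⟩ := s
    obtain ⟨q, rfl⟩ := hs
    have hg₁ := congrFun (congrFun hF₁ q.1) q.2
    have hg₂ := congrFun (congrFun hG q.1) q.2
    rw [Matrix.map_apply, Matrix.mul_apply] at hg₁
    refine ⟨∑ l, algebraMap K _ (A q.1 l) *
      ⟨F₁ l q.2, IntermediateField.subset_adjoin _ _ ⟨(l, q.2), rfl⟩⟩, ?_, ?_⟩
    · refine hg₁.trans ?_
      rw [IntermediateField.coe_sum]
      rfl
    · refine (congrArg d₂.d (hφ q)).trans (hg₂.trans ?_)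
      rw [map_sum, Matrix.mul_apply]
      refine Finset.sum_congr rfl fun l _ => ?_
      rw [map_mul, AlgHom.commutes]
      exact congrArg _ (hφ (l, q.2)).symm

end FundamentalIsomorphism

section RelativeAlgebraicClosure

theorem isSquare_of_isSquare_algebraMap {K K₁ N : Type} [Field K] [Field K₁] [Field N]
    [Algebra K K₁] [Algebra K N] [Algebra K₁ N] [IsScalarTower K K₁ N]
    (hK₁ : ∀ x : N, x ∈ Set.range (algebraMap K₁ N) ↔ IsAlgebraic K x) {x : K}
    (hx : IsSquare (algebraMap K N x)) : IsSquare (algebraMap K K₁ x) := by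
  obtain ⟨y, hy⟩ := hx
  have hy' : IsAlgebraic K y := by
    refine IsAlgebraic.of_pow two_pos ?_
    rw [pow_two, ← hy]
    exact isAlgebraic_algebraMap x
  obtain ⟨z, rfl⟩ := (hK₁ y).2 hy'
  refine ⟨z, (algebraMap K₁ N).injective ?_⟩
  rw [← IsScalarTower.algebraMap_apply, hy, map_mul]

theorem FieldDeriv.exists_of_isAlgebraic {K E : Type} [Field K] [CharZero K] [Field E]
    [Algebra K E] [Algebra.IsAlgebraic K E] (dK : FieldDeriv K) {N₀ : Type} [Field N₀]
    [Algebra K N₀] (d₀ : FieldDeriv N₀)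
    (h₀ : ∀ a, d₀.d (algebraMap K N₀ a) = algebraMap K N₀ (dK.d a)) (g₀ : E →ₐ[K] N₀) :
    ∃ D : FieldDeriv E, ∀ (N : Type) [Field N] [Algebra K N] (dN : FieldDeriv N),
      (∀ a, dN.d (algebraMap K N a) = algebraMap K N (dK.d a)) →
        ∀ (g : E →ₐ[K] N) (a : E), dN.d (g a) = g (D.d a) := by
  obtain ⟨D, hD⟩ := FieldDeriv.exists_extension_of_isAlgebraic (E := E) dK
  have h := hD N₀ d₀ h₀ g₀
  have inj : Function.Injective g₀ := g₀.toRingHom.injective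
  refine ⟨⟨D, fun a b => inj ?_, fun a b => inj ?_⟩, hD⟩
  · rw [_root_.map_add, ← h, ← h, ← h, _root_.map_add, d₀.map_add]
  · rw [_root_.map_add, map_mul, map_mul, ← h, ← h, ← h, map_mul, d₀.leibniz]

end RelativeAlgebraicClosure

section Compositum

theorem FieldDeriv.compositum_isPicardVessiot {K k L N K₁ : Type} [Field K] [Field k] [Algebra k K]
    [Field L] [Field N] [Field K₁] [Algebra K L] [Algebra L N] [Algebra K N]
    [IsScalarTower K L N] [Algebra K K₁] [Algebra K₁ N] [IsScalarTower K K₁ N]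
    {dK : FieldDeriv K} {dL : FieldDeriv L} {dN : FieldDeriv N} {D : FieldDeriv K₁}
    (hconst : ∀ a : K, dK.d a = 0 ↔ a ∈ Set.range (algebraMap k K)) (hk : IsRealClosedField k)
    {n : ℕ} {A : Matrix (Fin n) (Fin n) K} (hPV : IsPicardVessiot dK dL A)
    (hN : IsFormallyRealField N) (halg : Algebra.IsAlgebraic L N)
    (hd : ∀ x, dN.d (algebraMap L N x) = algebraMap L N (dL.d x))
    (hD : ∀ a, dN.d (algebraMap K₁ N a) = algebraMap K₁ N (D.d a))
    (M : IntermediateField K₁ N)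
    (hM : M = IntermediateField.adjoin K₁ (Set.range (algebraMap L N))) :
    (∀ x : N, x ∈ M → dN.d x ∈ M) ∧ IsFormallyRealField M ∧
      ∃ F : Matrix (Fin n) (Fin n) N, (∀ i j, F i j ∈ M) ∧ IsUnit F.det ∧
        (∀ i j, dN.d (F i j) = (A.map (algebraMap K N) * F) i j) ∧
        IntermediateField.adjoin K₁ (Set.range fun q : Fin n × Fin n => F q.1 q.2) = M ∧
        ∀ x : N, x ∈ M → dN.d x = 0 → ∃ a : K, dK.d a = 0 ∧ algebraMap K N a = x := by
  obtain ⟨-, F, hdet, hdF, hgen, hL⟩ := hPV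
  subst hM
  refine ⟨fun x hx => dN.mem_adjoin (fun a => hD a ▸ algebraMap_mem _ _) ?_ hx,
    IsFormallyRealField.of_ringHom (algebraMap _ N) hN, F.map (algebraMap L N),
    fun i j => IntermediateField.subset_adjoin _ _ ⟨F i j, rfl⟩, ?_, fun i j => ?_, ?_,
    fun x _ hx => ?_⟩
  · rintro _ ⟨y, rfl⟩
    rw [hd]
    exact IntermediateField.subset_adjoin _ _ ⟨_, rfl⟩
  · have := hdet.map (algebraMap L N)
    rwa [RingHom.map_det] at this
  · simp only [Matrix.map_apply, Matrix.mul_apply, hd, hdF, map_sum, map_mul,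
      ← IsScalarTower.algebraMap_apply]
  · rw [← IntermediateField.adjoin_image_eq_of_adjoin_eq_top (K₁ := K₁) (N := N) hgen,
      ← Set.range_comp]
    rfl
  · obtain ⟨c, hc⟩ := FieldDeriv.exists_const_of_eq_zero hconst hk hL hN halg hd hx
    exact ⟨algebraMap k K c, (hconst _).2 ⟨c, rfl⟩, hc⟩

/-- Mutually inverse differential embeddings of two Picard--Vessiot fields into extensions of each
other without new constants restrict to an isomorphism. -/
theorem FieldDeriv.exists_algEquiv_of_compositum {K L₁ L₂ N₁ N₂ : Type} [Field K]
    [Field L₁] [Field L₂] [Field N₁] [Field N₂] [Algebra K L₁] [Algebra K L₂] [Algebra L₁ N₁]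
    [Algebra L₂ N₂] [Algebra K N₁] [Algebra K N₂] [IsScalarTower K L₁ N₁] [IsScalarTower K L₂ N₂]
    {dK : FieldDeriv K} {d₁ : FieldDeriv L₁} {d₂ : FieldDeriv L₂} {e₁ : FieldDeriv N₁}
    {e₂ : FieldDeriv N₂} {n : ℕ} {A : Matrix (Fin n) (Fin n) K}
    (hPV₁ : IsPicardVessiot dK d₁ A) (hPV₂ : IsPicardVessiot dK d₂ A)
    (hd₁ : ∀ x, e₁.d (algebraMap L₁ N₁ x) = algebraMap L₁ N₁ (d₁.d x))
    (hd₂ : ∀ x, e₂.d (algebraMap L₂ N₂ x) = algebraMap L₂ N₂ (d₂.d x))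
    (hc₁ : ∀ x : N₁, e₁.d x = 0 → x ∈ Set.range (algebraMap K N₁))
    (hc₂ : ∀ x : N₂, e₂.d x = 0 → x ∈ Set.range (algebraMap K N₂))
    (Φ : L₁ →ₐ[K] N₂) (Ψ : L₂ →ₐ[K] N₁)
    (hΦ : ∀ x, e₂.d (Φ x) = Φ (d₁.d x)) (hΨ : ∀ x, e₁.d (Ψ x) = Ψ (d₂.d x))
    (hΦΨ : ∀ x y, Φ x = algebraMap L₂ N₂ y ↔ Ψ y = algebraMap L₁ N₁ x) :
    ∃ φ : L₁ ≃ₐ[K] L₂, ∀ x, φ (d₁.d x) = d₂.d (φ x) := by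
  obtain ⟨-, F₁, hdet₁, hdF₁, hgen₁, -⟩ := hPV₁
  obtain ⟨-, F₂, hdet₂, hdF₂, hgen₂, -⟩ := hPV₂
  choose f hf using FieldDeriv.mem_range_of_fundamentalMatrix hdet₂ hdF₁ hdF₂ hgen₁ hd₂ hc₂ Φ hΦ
  choose g hg using FieldDeriv.mem_range_of_fundamentalMatrix hdet₁ hdF₂ hdF₁ hgen₂ hd₁ hc₁ Ψ hΨ
  have inj₁ := (algebraMap L₁ N₁).injective
  have inj₂ := (algebraMap L₂ N₂).injective
  refine ⟨{ toFun := f, invFun := g, left_inv := fun x => inj₁ ?_,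
            right_inv := fun y => inj₂ ?_, map_mul' := fun x y => inj₂ ?_,
            map_add' := fun x y => inj₂ ?_, commutes' := fun a => inj₂ ?_ },
    fun x => inj₂ ?_⟩
  · rw [hg, ← hΦΨ, hf]
  · rw [hf, hΦΨ, hg]
  · rw [map_mul, hf, hf, hf, map_mul]
  · rw [_root_.map_add, hf, hf, hf, _root_.map_add]
  · rw [hf, AlgHom.commutes, ← IsScalarTower.algebraMap_apply]
  · change algebraMap L₂ N₂ (f _) = algebraMap L₂ N₂ (d₂.d (f x))
    rw [← hd₂, hf, hf, hΦ]

end Compositum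

section CompositumIsomorphism

theorem FieldDeriv.exists_ringEquiv_adjoin {k K K₁ K₂ N₁ N₂ : Type} [Field k] [Field K] [Field K₁]
    [Field K₂] [Field N₁] [Field N₂] [Algebra k K] [Algebra K K₁] [Algebra K K₂] [Algebra K N₁]
    [Algebra K N₂] [Algebra K₁ N₁] [Algebra K₂ N₂] [IsScalarTower K K₁ N₁] [IsScalarTower K K₂ N₂]
    (hk : IsRealClosedField k) (hK₁ : IsRealClosedField K₁) (hN₁ : IsRealClosedField N₁)
    (hN₂ : IsRealClosedField N₂) (ψ : K₁ ≃ₐ[K] K₂)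
    {D : FieldDeriv K₁} {d₁ : FieldDeriv N₁} {d₂ : FieldDeriv N₂}
    (h₁ : ∀ a, d₁.d (algebraMap K₁ N₁ a) = algebraMap K₁ N₁ (D.d a))
    (h₂ : ∀ a, d₂.d (algebraMap K₂ N₂ (ψ a)) = algebraMap K₂ N₂ (ψ (D.d a)))
    (hD : ∀ c : k, D.d (algebraMap K K₁ (algebraMap k K c)) = 0)
    (hc₁ : ∀ x : N₁, d₁.d x = 0 → ∃ c : k, algebraMap K N₁ (algebraMap k K c) = x)
    (hc₂ : ∀ x : N₂, d₂.d x = 0 → ∃ c : k, algebraMap K N₂ (algebraMap k K c) = x)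
    {n : ℕ} {A : Matrix (Fin n) (Fin n) K} {F₁ : Matrix (Fin n) (Fin n) N₁}
    {F₂ : Matrix (Fin n) (Fin n) N₂} (hdet₁ : IsUnit F₁.det) (hdet₂ : IsUnit F₂.det)
    (hF₁ : ∀ i j, d₁.d (F₁ i j) = (A.map (algebraMap K N₁) * F₁) i j)
    (hF₂ : ∀ i j, d₂.d (F₂ i j) = (A.map (algebraMap K N₂) * F₂) i j)
    {M₁ : IntermediateField K₁ N₁} {M₂ : IntermediateField K₂ N₂}
    (hM₁ : IntermediateField.adjoin K₁ (Set.range fun q : Fin n × Fin n => F₁ q.1 q.2) = M₁)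
    (hM₂ : IntermediateField.adjoin K₂ (Set.range fun q : Fin n × Fin n => F₂ q.1 q.2) = M₂) :
    ∃ φ : M₁ ≃+* M₂, (∀ a : K₁, φ (algebraMap K₁ M₁ a) = algebraMap K₂ M₂ (ψ a)) ∧
      ∀ x y : M₁, d₁.d (x : N₁) = (y : N₁) → d₂.d (φ x : N₂) = (φ y : N₂) := by
  subst hM₁ hM₂
  let _ : Algebra K₁ N₂ := ((algebraMap K₂ N₂).comp (ψ : K₁ →+* K₂)).toAlgebra
  let _ : Algebra k K₁ := ((algebraMap K K₁).comp (algebraMap k K)).toAlgebra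
  let _ : Algebra k N₁ := ((algebraMap K N₁).comp (algebraMap k K)).toAlgebra
  let _ : Algebra k N₂ := ((algebraMap K N₂).comp (algebraMap k K)).toAlgebra
  have hψ : ∀ a, algebraMap K₁ N₂ a = algebraMap K₂ N₂ (ψ a) := fun _ => rfl
  have : IsScalarTower K K₁ N₂ := IsScalarTower.of_algebraMap_eq fun c => by
    rw [hψ, ψ.commutes, ← IsScalarTower.algebraMap_apply]
  have : IsScalarTower k K₁ N₁ := IsScalarTower.of_algebraMap_eq fun c =>
    IsScalarTower.algebraMap_apply K K₁ N₁ _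
  have : IsScalarTower k K₁ N₂ := IsScalarTower.of_algebraMap_eq fun c =>
    IsScalarTower.algebraMap_apply K K₁ N₂ _
  have e₁ : F₁.map d₁.d = (A.map (algebraMap K K₁)).map (algebraMap K₁ N₁) * F₁ := by
    ext i j
    rw [Matrix.map_apply, hF₁, Matrix.mul_apply, Matrix.mul_apply]
    simp only [Matrix.map_apply, ← IsScalarTower.algebraMap_apply]
  have e₂ : F₂.map d₂.d = (A.map (algebraMap K K₁)).map (algebraMap K₁ N₂) * F₂ := by
    ext i j
    rw [Matrix.map_apply, hF₂, Matrix.mul_apply, Matrix.mul_apply]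
    simp only [Matrix.map_apply, ← IsScalarTower.algebraMap_apply]
  obtain ⟨φ, hφ⟩ := FieldDeriv.exists_algEquiv_adjoin hk hK₁ hN₁ hN₂ h₁ h₂ hD hc₁ hc₂ hdet₁ hdet₂
    e₁ e₂
  have he := IntermediateField.restrictScalars_adjoin_of_algEquiv (F := K) (E := N₂) ψ
    (funext hψ) (Set.range fun q : Fin n × Fin n => F₂ q.1 q.2)
  refine ⟨φ.toRingEquiv.trans (IntermediateField.equivOfEq he).toRingEquiv, fun a => ?_, hφ⟩
  have h : (φ (algebraMap K₁ _ a) : N₂) = algebraMap K₁ N₂ a := congrArg Subtype.val (φ.commutes a)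
  exact Subtype.ext h

end CompositumIsomorphism

/-- Reduction of unicity to the real closed case (Lemma 2.2 of the paper).
`L₁, L₂` are real Picard--Vessiot fields for `y' = A y` over `K`, with orderings `τ₁, τ₂`
restricting to the same ordering `τ` of `K`; `Lⱼr` is a real closure of `(Lⱼ, τⱼ)` with the
unique derivation extending that of `Lⱼ`, and `Kⱼ` is the relative algebraic closure of `K`
in `Lⱼr`.  Then (a) each `Kⱼ` is a real closure of `(K, τ)`; (b) the compositum
`L̃ⱼ = Kⱼ·Lⱼ` inside `Lⱼr` is a real Picard--Vessiot field for `y' = A y` over `Kⱼ`; and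
(c) identifying `K₁` with `K₂` via the unique `K`-isomorphism, `L̃₁ ≅ L̃₂` as differential
extensions of the common real closure iff `L₁ ≅ L₂` as differential extensions of `K`. -/
theorem real_picard_vessiot_reduction_to_real_closed
    (K : Type) [Field K] [CharZero K] (dK : FieldDeriv K)
    (hKreal : IsFormallyRealField K)
    (k : Type) [Field k] [Algebra k K]
    (hconst : ∀ a : K, dK.d a = 0 ↔ a ∈ Set.range (algebraMap k K))
    (hkrc : IsRealClosedField k)
    (n : ℕ) (A : Matrix (Fin n) (Fin n) K)
    -- the two real Picard--Vessiot fields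
    (L₁ L₂ : Type) [Field L₁] [Field L₂] [Algebra K L₁] [Algebra K L₂]
    (d₁ : FieldDeriv L₁) (d₂ : FieldDeriv L₂)
    (hPV₁ : IsPicardVessiot dK d₁ A) (hreal₁ : IsFormallyRealField L₁)
    (hPV₂ : IsPicardVessiot dK d₂ A) (hreal₂ : IsFormallyRealField L₂)
    -- orderings restricting to the same ordering `τ` of `K`
    (τ₁ : FieldOrdering L₁) (τ₂ : FieldOrdering L₂)
    (hττ : (algebraMap K L₁) ⁻¹' τ₁.P = (algebraMap K L₂) ⁻¹' τ₂.P)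
    -- real closures `Lⱼr` of `(Lⱼ, τⱼ)`
    (L₁r L₂r : Type) [Field L₁r] [Field L₂r]
    [Algebra L₁ L₁r] [Algebra L₂ L₂r] [Algebra K L₁r] [Algebra K L₂r]
    [IsScalarTower K L₁ L₁r] [IsScalarTower K L₂ L₂r]
    (hrc₁ : IsRealClosedField L₁r) (hrc₂ : IsRealClosedField L₂r)
    (halg₁ : Algebra.IsAlgebraic L₁ L₁r) (halg₂ : Algebra.IsAlgebraic L₂ L₂r)
    (hord₁ : ∀ x ∈ τ₁.P, IsSquare (algebraMap L₁ L₁r x))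
    (hord₂ : ∀ x ∈ τ₂.P, IsSquare (algebraMap L₂ L₂r x))
    -- the unique derivations of `Lⱼr` extending those of `Lⱼ`
    (d₁r : FieldDeriv L₁r) (d₂r : FieldDeriv L₂r)
    (hd₁r : ∀ x : L₁, d₁r.d (algebraMap L₁ L₁r x) = algebraMap L₁ L₁r (d₁.d x))
    (hd₂r : ∀ x : L₂, d₂r.d (algebraMap L₂ L₂r x) = algebraMap L₂ L₂r (d₂.d x))
    -- `Kⱼ`: the relative algebraic closure of `K` in `Lⱼr`
    (K₁ K₂ : Type) [Field K₁] [Field K₂]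
    [Algebra K K₁] [Algebra K K₂] [Algebra K₁ L₁r] [Algebra K₂ L₂r]
    [IsScalarTower K K₁ L₁r] [IsScalarTower K K₂ L₂r]
    (hK₁ : ∀ x : L₁r, x ∈ Set.range (algebraMap K₁ L₁r) ↔ IsAlgebraic K x)
    (hK₂ : ∀ x : L₂r, x ∈ Set.range (algebraMap K₂ L₂r) ↔ IsAlgebraic K x)
    -- the composita `L̃ⱼ = Kⱼ · Lⱼ` inside `Lⱼr`
    (Lt₁ : IntermediateField K₁ L₁r)
    (hLt₁ : Lt₁ = IntermediateField.adjoin K₁ (Set.range (algebraMap L₁ L₁r)))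
    (Lt₂ : IntermediateField K₂ L₂r)
    (hLt₂ : Lt₂ = IntermediateField.adjoin K₂ (Set.range (algebraMap L₂ L₂r))) :
    -- (a) each `Kⱼ` is a real closure of `(K, τ)`
    (IsRealClosedField K₁ ∧ Algebra.IsAlgebraic K K₁ ∧
      ∀ x : K, algebraMap K L₁ x ∈ τ₁.P → IsSquare (algebraMap K K₁ x)) ∧
    (IsRealClosedField K₂ ∧ Algebra.IsAlgebraic K K₂ ∧
      ∀ x : K, algebraMap K L₂ x ∈ τ₂.P → IsSquare (algebraMap K K₂ x)) ∧
    -- (b) each `L̃ⱼ` is a real Picard--Vessiot field for `y' = A y` over `Kⱼ`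
    ((∀ x : L₁r, x ∈ Lt₁ → d₁r.d x ∈ Lt₁) ∧ IsFormallyRealField Lt₁ ∧
      ∃ F : Matrix (Fin n) (Fin n) L₁r, (∀ i j, F i j ∈ Lt₁) ∧ IsUnit F.det ∧
        (∀ i j, d₁r.d (F i j) = (A.map (algebraMap K L₁r) * F) i j) ∧
        IntermediateField.adjoin K₁ (Set.range fun q : Fin n × Fin n => F q.1 q.2) = Lt₁ ∧
        ∀ x : L₁r, x ∈ Lt₁ → d₁r.d x = 0 →
          ∃ a : K, dK.d a = 0 ∧ algebraMap K L₁r a = x) ∧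
    ((∀ x : L₂r, x ∈ Lt₂ → d₂r.d x ∈ Lt₂) ∧ IsFormallyRealField Lt₂ ∧
      ∃ F : Matrix (Fin n) (Fin n) L₂r, (∀ i j, F i j ∈ Lt₂) ∧ IsUnit F.det ∧
        (∀ i j, d₂r.d (F i j) = (A.map (algebraMap K L₂r) * F) i j) ∧
        IntermediateField.adjoin K₂ (Set.range fun q : Fin n × Fin n => F q.1 q.2) = Lt₂ ∧
        ∀ x : L₂r, x ∈ Lt₂ → d₂r.d x = 0 →
          ∃ a : K, dK.d a = 0 ∧ algebraMap K L₂r a = x) ∧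
    -- (c) after identifying `K₁` with `K₂` via the unique `K`-isomorphism
    (∀ ψ : K₁ ≃ₐ[K] K₂,
      ((∃ φ : Lt₁ ≃+* Lt₂,
          (∀ a : K₁, φ (algebraMap K₁ Lt₁ a) = algebraMap K₂ Lt₂ (ψ a)) ∧
          ∀ x y : Lt₁, d₁r.d (x : L₁r) = (y : L₁r) →
            d₂r.d ((φ x : L₂r)) = ((φ y : L₂r))) ↔
        (∃ φ : L₁ ≃ₐ[K] L₂, ∀ x : L₁, φ (d₁.d x) = d₂.d (φ x)))) := by
  have hdK₁ : ∀ a, d₁r.d (algebraMap K L₁r a) = algebraMap K L₁r (dK.d a) := fun a => by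
    rw [IsScalarTower.algebraMap_apply K L₁ L₁r, hd₁r, hPV₁.1, ← IsScalarTower.algebraMap_apply]
  have hdK₂ : ∀ a, d₂r.d (algebraMap K L₂r a) = algebraMap K L₂r (dK.d a) := fun a => by
    rw [IsScalarTower.algebraMap_apply K L₂ L₂r, hd₂r, hPV₂.1, ← IsScalarTower.algebraMap_apply]
  obtain ⟨hK₁rc, hK₁alg⟩ := hrc₁.of_relative_algebraicClosure hK₁
  obtain ⟨hK₂rc, hK₂alg⟩ := hrc₂.of_relative_algebraicClosure hK₂
  obtain ⟨D₁, hD₁⟩ := dK.exists_of_isAlgebraic d₁r hdK₁ (IsScalarTower.toAlgHom K K₁ L₁r)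
  obtain ⟨D₂, hD₂⟩ := dK.exists_of_isAlgebraic d₂r hdK₂ (IsScalarTower.toAlgHom K K₂ L₂r)
  have hb₁ := FieldDeriv.compositum_isPicardVessiot hconst hkrc hPV₁ hrc₁.1 halg₁ hd₁r
    (hD₁ L₁r d₁r hdK₁ (IsScalarTower.toAlgHom K K₁ L₁r)) Lt₁ hLt₁
  have hb₂ := FieldDeriv.compositum_isPicardVessiot hconst hkrc hPV₂ hrc₂.1 halg₂ hd₂r
    (hD₂ L₂r d₂r hdK₂ (IsScalarTower.toAlgHom K K₂ L₂r)) Lt₂ hLt₂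
  have hc₁ : ∀ x : L₁r, d₁r.d x = 0 → ∃ c : k, algebraMap K L₁r (algebraMap k K c) = x :=
    fun x hx => FieldDeriv.exists_const_of_eq_zero hconst hkrc hPV₁.2.choose_spec.2.2.2 hrc₁.1
      halg₁ hd₁r hx
  have hc₂ : ∀ x : L₂r, d₂r.d x = 0 → ∃ c : k, algebraMap K L₂r (algebraMap k K c) = x :=
    fun x hx => FieldDeriv.exists_const_of_eq_zero hconst hkrc hPV₂.2.choose_spec.2.2.2 hrc₂.1
      halg₂ hd₂r hx
  refine ⟨⟨hK₁rc, hK₁alg, fun x hx => isSquare_of_isSquare_algebraMap hK₁ ?_⟩,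
    ⟨hK₂rc, hK₂alg, fun x hx => isSquare_of_isSquare_algebraMap hK₂ ?_⟩, hb₁, hb₂,
    fun ψ => ⟨?_, fun _ => ?_⟩⟩
  · rw [IsScalarTower.algebraMap_apply K L₁ L₁r]
    exact hord₁ _ hx
  · rw [IsScalarTower.algebraMap_apply K L₂ L₂r]
    exact hord₂ _ hx
  · rintro ⟨φ, hφψ, hφ⟩
    have hmem₁ : ∀ x : L₁, algebraMap L₁ L₁r x ∈ Lt₁ := fun x =>
      hLt₁ ▸ IntermediateField.subset_adjoin _ _ ⟨x, rfl⟩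
    have hmem₂ : ∀ x : L₂, algebraMap L₂ L₂r x ∈ Lt₂ := fun x =>
      hLt₂ ▸ IntermediateField.subset_adjoin _ _ ⟨x, rfl⟩
    let i₁ : L₁ →+* Lt₁ := (algebraMap L₁ L₁r).codRestrict Lt₁ hmem₁
    let i₂ : L₂ →+* Lt₂ := (algebraMap L₂ L₂r).codRestrict Lt₂ hmem₂
    have hi₁ : ∀ a : K, i₁ (algebraMap K L₁ a) = algebraMap K₁ Lt₁ (algebraMap K K₁ a) :=
      fun a => Subtype.ext <| (IsScalarTower.algebraMap_apply K L₁ L₁r a).symm.trans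
        (IsScalarTower.algebraMap_apply K K₁ L₁r a)
    have hi₂ : ∀ a : K, i₂ (algebraMap K L₂ a) = algebraMap K₂ Lt₂ (algebraMap K K₂ a) :=
      fun a => Subtype.ext <| (IsScalarTower.algebraMap_apply K L₂ L₂r a).symm.trans
        (IsScalarTower.algebraMap_apply K K₂ L₂r a)
    have hφK : ∀ a : K, φ (algebraMap K₁ Lt₁ (algebraMap K K₁ a)) =
        algebraMap K₂ Lt₂ (algebraMap K K₂ a) := fun a => by rw [hφψ, ψ.commutes]
    let Φ : L₁ →ₐ[K] L₂r :=
      { toRingHom := (algebraMap Lt₂ L₂r).comp ((φ : Lt₁ →+* Lt₂).comp i₁)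
        commutes' := fun a => by
          change ((φ (i₁ (algebraMap K L₁ a)) : Lt₂) : L₂r) = _
          rw [hi₁, hφK, IsScalarTower.algebraMap_apply K K₂ L₂r]
          rfl }
    let Ψ : L₂ →ₐ[K] L₁r :=
      { toRingHom := (algebraMap Lt₁ L₁r).comp ((φ.symm : Lt₂ →+* Lt₁).comp i₂)
        commutes' := fun a => by
          change ((φ.symm (i₂ (algebraMap K L₂ a)) : Lt₁) : L₁r) = _
          rw [hi₂, ← hφK, RingEquiv.symm_apply_apply, IsScalarTower.algebraMap_apply K K₁ L₁r]
          rfl }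
    refine FieldDeriv.exists_algEquiv_of_compositum hPV₁ hPV₂ hd₁r hd₂r
      (fun x hx => (hc₁ x hx).imp' _ fun c hc => hc) (fun x hx => (hc₂ x hx).imp' _ fun c hc => hc)
      Φ Ψ (fun x => hφ (i₁ x) (i₁ (d₁.d x)) (hd₁r x)) (fun y => ?_) fun x y => ?_
    · have hz : d₁r.d (φ.symm (i₂ y) : L₁r) ∈ Lt₁ := hb₁.1 _ (SetLike.coe_mem _)
      have h := hφ (φ.symm (i₂ y)) ⟨_, hz⟩ rfl
      rw [RingEquiv.apply_symm_apply] at h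
      have h' : φ ⟨_, hz⟩ = i₂ (d₂.d y) := Subtype.ext (h.symm.trans (hd₂r y))
      exact congrArg Subtype.val ((RingEquiv.eq_symm_apply φ).2 h')
    · have h : φ (i₁ x) = i₂ y ↔ φ.symm (i₂ y) = i₁ x := by
        rw [RingEquiv.symm_apply_eq, eq_comm]
      exact Subtype.ext_iff.symm.trans (h.trans Subtype.ext_iff)
  · obtain ⟨-, -, F₁, -, hdet₁, hdF₁, hgen₁, -⟩ := hb₁
    obtain ⟨-, -, F₂, -, hdet₂, hdF₂, hgen₂, -⟩ := hb₂
    refine FieldDeriv.exists_ringEquiv_adjoin hkrc hK₁rc hrc₁ hrc₂ ψ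
      (hD₁ L₁r d₁r hdK₁ (IsScalarTower.toAlgHom K K₁ L₁r))
      (hD₁ L₂r d₂r hdK₂ ((IsScalarTower.toAlgHom K K₂ L₂r).comp ψ.toAlgHom)) (fun c => ?_)
      hc₁ hc₂ hdet₁ hdet₂ hdF₁ hdF₂ hgen₁ hgen₂
    refine (algebraMap K₁ L₁r).injective ?_
    have h := hD₁ L₁r d₁r hdK₁ (IsScalarTower.toAlgHom K K₁ L₁r)
      (algebraMap K K₁ (algebraMap k K c))
    rw [AlgHom.commutes, hdK₁, (hconst _).2 ⟨c, rfl⟩, map_zero] at h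
    rw [map_zero]
    exact h.symm
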